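/- arXiv:2209.12540 — 2 statements merged into one kernel-verified Lean document; each statement's English description precedes it below -/
import Mathlib

section
/- Let W be an irreducible finite real reflection group with Coxeter element c and Coxeter number h. Then each orbit of the action of c on the set of reflections T by conjugation either has cardinality h/2 and contains exactly one right inversion of c, or has cardinality h and contains exactly two right inversions of c. -/
namespace Stmt3

section GeometricRepresentation

open CoxeterSystem

variable {B W : Type*} [Group W] {M : CoxeterMatrix B}

/-- The entries of the Gram matrix of the simple roots. -/
noncomputable def gram (M : CoxeterMatrix B) (i j : B) : ℝ := -Real.cos (Real.pi / M i j)

lemma gram_self (i : B) : gram M i i = 1 := by simp [gram]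

lemma gram_symm (i j : B) : gram M i j = gram M j i := by simp [gram, M.symmetric i j]

lemma two_le_of_ne {i j : B} (hij : i ≠ j) (h0 : M i j ≠ 0) : 2 ≤ M i j := by
  have := M.off_diagonal i j hij
  omega

variable [Fintype B]

/-- The inner product with the simple root indexed by `i`. -/
noncomputable def pair (M : CoxeterMatrix B) (i : B) : (B → ℝ) →ₗ[ℝ] ℝ :=
  ∑ j, gram M j i • LinearMap.proj j

lemma pair_apply (i : B) (v : B → ℝ) : pair M i v = ∑ j, v j * gram M j i := by
  simp [pair, mul_comm]

variable [DecidableEq B]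

/-- The simple root indexed by `i`. -/
def simpleRoot (i : B) : B → ℝ := Pi.single i 1

/-- The reflection in the simple root indexed by `i`. -/
noncomputable def simpleRefl (M : CoxeterMatrix B) (i : B) : Module.End ℝ (B → ℝ) :=
  LinearMap.id - ((2 : ℝ) • pair M i).smulRight (simpleRoot i)

lemma pair_simpleRoot (i j : B) : pair M i (simpleRoot j) = gram M j i := by
  simp [pair_apply, simpleRoot, Pi.single_apply]

lemma simpleRefl_apply (i : B) (v : B → ℝ) :
    simpleRefl M i v = v - (2 * pair M i v) • simpleRoot i := by
  simp [simpleRefl]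

lemma simpleRefl_apply_self (i : B) (v : B → ℝ) :
    simpleRefl M i v i = v i - 2 * pair M i v := by
  simp [simpleRefl_apply, simpleRoot]

lemma simpleRefl_apply_of_ne {i j : B} (h : j ≠ i) (v : B → ℝ) :
    simpleRefl M i v j = v j := by
  simp [simpleRefl_apply, simpleRoot, h]

lemma simpleRefl_simpleRoot (i j : B) :
    simpleRefl M i (simpleRoot j) = simpleRoot j - (2 * gram M j i) • simpleRoot i := by
  rw [simpleRefl_apply, pair_simpleRoot]

lemma simpleRefl_simpleRoot_self (i : B) :
    simpleRefl M i (simpleRoot i) = -simpleRoot i := by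
  rw [simpleRefl_simpleRoot, gram_self]; module

lemma simpleRefl_mul_self (i : B) : simpleRefl M i * simpleRefl M i = 1 := by
  refine LinearMap.ext fun v => ?_
  rw [Module.End.mul_apply, simpleRefl_apply i v, map_sub, map_smul, simpleRefl_simpleRoot_self,
    simpleRefl_apply, Module.End.one_apply]
  module

lemma two_mul_sin_add (x y : ℝ) :
    2 * Real.cos y * Real.sin (x + y) = Real.sin x + Real.sin (x + 2 * y) := by
  have h1 : Real.sin x = Real.sin ((x + y) - y) := by ring_nf
  have h2 : Real.sin (x + 2 * y) = Real.sin ((x + y) + y) := by ring_nf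
  rw [h1, h2, Real.sin_sub, Real.sin_add (x + y) y]; ring

lemma sin_pos_of_two_le {m : ℕ} (hm : 2 ≤ m) : 0 < Real.sin (Real.pi / m) := by
  have : (2 : ℝ) ≤ m := by exact_mod_cast hm
  apply Real.sin_pos_of_pos_of_lt_pi (by positivity)
  rw [div_lt_iff₀ (by linarith)]
  nlinarith [Real.pi_pos]

lemma simpleRefl_mul_pow_simpleRoot_left (i j : B) (k : ℕ) :
    Real.sin (Real.pi / M i j) • ((simpleRefl M i * simpleRefl M j) ^ k) (simpleRoot i) =
      Real.sin ((2 * k + 1) * (Real.pi / M i j)) • simpleRoot i +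
        Real.sin (2 * k * (Real.pi / M i j)) • simpleRoot j := by
  induction k with
  | zero => simp
  | succ k ih =>
    rw [pow_succ', Module.End.mul_apply, ← map_smul, ih]
    set θ := Real.pi / M i j with hθ
    have hg : gram M i j = -Real.cos θ := rfl
    have hg' : gram M j i = -Real.cos θ := by rw [gram_symm, hg]
    simp only [Module.End.mul_apply, map_add, map_smul, simpleRefl_simpleRoot, map_sub, hg, hg',
      gram_self]
    have e1 := two_mul_sin_add (2 * k * θ) θ
    have e2 := two_mul_sin_add ((2 * k + 1) * θ) θ
    have r1 : (2 * k + 1) * θ = 2 * k * θ + θ := by ring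
    have r2 : 2 * ((k + 1 : ℕ) : ℝ) * θ = 2 * k * θ + 2 * θ := by push_cast; ring
    have r3 : (2 * k + 1) * θ + θ = 2 * k * θ + 2 * θ := by ring
    have r4 : (2 * ((k + 1 : ℕ) : ℝ) + 1) * θ = (2 * k + 1) * θ + 2 * θ := by push_cast; ring
    rw [r2, r4]
    rw [r3] at e2
    rw [← r1] at e1
    have e1' : Real.sin (2 * k * θ + 2 * θ) =
      2 * Real.cos θ * Real.sin ((2 * k + 1) * θ) - Real.sin (2 * k * θ) := by linarith
    have e2' : Real.sin ((2 * k + 1) * θ + 2 * θ) =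
      2 * Real.cos θ * Real.sin (2 * k * θ + 2 * θ) - Real.sin ((2 * k + 1) * θ) := by linarith
    rw [e2', e1']
    module

lemma simpleRefl_isLiftable (M : CoxeterMatrix B) : M.IsLiftable (simpleRefl M) := by
  intro i j
  by_cases hij : i = j
  · subst hij; simp [simpleRefl_mul_self]
  by_cases h0 : M i j = 0
  · simp [h0]
  have hm := two_le_of_ne hij h0
  have key : ∀ a b : B, M a b = M i j →
      ((simpleRefl M a * simpleRefl M b) ^ M i j) (simpleRoot a) = simpleRoot a := by
    intro a b hab
    have h := simpleRefl_mul_pow_simpleRoot_left (M := M) a b (M i j)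
    have hs := sin_pos_of_two_le hm
    rw [hab] at h
    have hne : (M i j : ℝ) ≠ 0 := by exact_mod_cast h0
    have r1 : (2 * (M i j : ℝ) + 1) * (Real.pi / M i j) = Real.pi / M i j + 2 * Real.pi := by
      field_simp; ring
    have r2 : 2 * (M i j : ℝ) * (Real.pi / M i j) = 2 * Real.pi := by field_simp
    rw [r1, r2, Real.sin_two_pi, Real.sin_add_two_pi, zero_smul, add_zero] at h
    exact (smul_right_inj hs.ne').mp h
  have hi := key i j rfl
  have hj : ((simpleRefl M i * simpleRefl M j) ^ M i j) (simpleRoot j) = simpleRoot j := by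
    have h := key j i (M.symmetric j i)
    have hinv : (simpleRefl M i * simpleRefl M j) ^ M i j *
        (simpleRefl M j * simpleRefl M i) ^ M i j = 1 := by
      have hab : (simpleRefl M i * simpleRefl M j) * (simpleRefl M j * simpleRefl M i) = 1 := by
        rw [mul_assoc, ← mul_assoc (simpleRefl M j), simpleRefl_mul_self, one_mul,
          simpleRefl_mul_self]
      have hba : (simpleRefl M j * simpleRefl M i) * (simpleRefl M i * simpleRefl M j) = 1 := by
        rw [mul_assoc, ← mul_assoc (simpleRefl M i), simpleRefl_mul_self, one_mul,
          simpleRefl_mul_self]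
      rw [← Commute.mul_pow (hab.trans hba.symm), hab, one_pow]
    conv_lhs => rw [← h]
    rw [← Module.End.mul_apply, hinv, Module.End.one_apply]
  have horth : ∀ v, pair M i v = 0 → pair M j v = 0 →
      ((simpleRefl M i * simpleRefl M j) ^ M i j) v = v := by
    intro v h1 h2
    have : ∀ k, ((simpleRefl M i * simpleRefl M j) ^ k) v = v := by
      intro k
      induction k with
      | zero => simp
      | succ k ih =>
        rw [pow_succ', Module.End.mul_apply, ih, Module.End.mul_apply]
        simp [simpleRefl_apply, h1, h2]
    exact this _
  refine LinearMap.ext fun v => ?_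
  have hs := sin_pos_of_two_le hm
  set C := Real.cos (Real.pi / M i j) with hC
  set S := Real.sin (Real.pi / M i j) with hS
  have hSC : S ^ 2 + C ^ 2 = 1 := Real.sin_sq_add_cos_sq _
  have hg : gram M i j = -C := rfl
  have hg' : gram M j i = -C := by rw [gram_symm, hg]
  set p := pair M i v
  set q := pair M j v
  set a := (p + C * q) / S ^ 2 with ha
  set b := (q + C * p) / S ^ 2 with hb
  have e1 : p - a + b * C = 0 := by
    rw [ha, hb]; field_simp; linear_combination p * hSC
  have e2 : q + a * C - b = 0 := by
    rw [ha, hb]; field_simp; linear_combination q * hSC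
  have h0 := horth (v - a • simpleRoot i - b • simpleRoot j)
    (by simp only [map_sub, map_smul, pair_simpleRoot, gram_self, hg', smul_eq_mul]
        linear_combination e1)
    (by simp only [map_sub, map_smul, pair_simpleRoot, gram_self, hg, smul_eq_mul]
        linear_combination e2)
  rw [map_sub, map_sub, map_smul, map_smul, hi, hj] at h0
  simpa using h0

/-- The geometric representation of a Coxeter group. -/
noncomputable def geomRep (cs : CoxeterSystem M W) : W →* Module.End ℝ (B → ℝ) :=
  cs.lift ⟨simpleRefl M, simpleRefl_isLiftable M⟩

variable (cs : CoxeterSystem M W)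

lemma geomRep_simple (i : B) : geomRep cs (cs.simple i) = simpleRefl M i := by
  simp [geomRep]

lemma geomRep_simple_simpleRoot_self (w : W) (i : B) :
    geomRep cs (w * cs.simple i) (simpleRoot i) = -geomRep cs w (simpleRoot i) := by
  rw [map_mul, geomRep_simple, Module.End.mul_apply, simpleRefl_simpleRoot_self, map_neg]

lemma geomRep_inv_apply_self (w : W) (v : B → ℝ) : geomRep cs w⁻¹ (geomRep cs w v) = v := by
  rw [← Module.End.mul_apply, ← map_mul, inv_mul_cancel, map_one, Module.End.one_apply]

lemma geomRep_self_apply_inv (w : W) (v : B → ℝ) : geomRep cs w (geomRep cs w⁻¹ v) = v := by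
  rw [← Module.End.mul_apply, ← map_mul, mul_inv_cancel, map_one, Module.End.one_apply]

lemma geomRep_injective_apply (w : W) : Function.Injective (geomRep cs w) :=
  Function.LeftInverse.injective (geomRep_inv_apply_self cs w)

/-- In a finite Coxeter group, no entry of the Coxeter matrix is infinite. -/
lemma coxeterMatrix_ne_zero [Finite W] (cs : CoxeterSystem M W) (i j : B) : M i j ≠ 0 := by
  intro h0
  have hij : i ≠ j := by rintro rfl; simp at h0
  have hg : gram M i j = -1 := by simp [gram, h0]
  have hg' : gram M j i = -1 := by rw [gram_symm, hg]
  have h : ∀ k : ℕ, (geomRep cs ((cs.simple i * cs.simple j) ^ k)) (simpleRoot i) =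
      simpleRoot i + (2 * k : ℝ) • (simpleRoot i + simpleRoot j) := by
    intro k
    induction k with
    | zero => simp
    | succ k ih =>
      rw [pow_succ', map_mul, Module.End.mul_apply, ih, map_mul, geomRep_simple, geomRep_simple]
      simp only [Module.End.mul_apply, map_add, map_smul, simpleRefl_simpleRoot, map_sub, hg, hg',
        gram_self]
      push_cast
      module
  have h1 := h (orderOf (cs.simple i * cs.simple j))
  rw [pow_orderOf_eq_one, map_one, Module.End.one_apply] at h1
  have h2 := congrFun h1 j
  have hpos := orderOf_pos (cs.simple i * cs.simple j)
  simp [simpleRoot, hij.symm, hpos.ne'] at h2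

lemma geomRep_alternatingWord (s t : B) (k : ℕ) :
    Real.sin (Real.pi / M s t) •
        geomRep cs (cs.wordProd (alternatingWord s t k)) (simpleRoot s) =
      Real.sin ((k + 1) * (Real.pi / M s t)) • simpleRoot (if Even k then s else t) +
        Real.sin (k * (Real.pi / M s t)) • simpleRoot (if Even k then t else s) := by
  induction k with
  | zero => simp [alternatingWord]
  | succ k ih =>
    rw [alternatingWord_succ', wordProd_cons, map_mul, Module.End.mul_apply, ← map_smul, ih]
    set θ := Real.pi / M s t with hθ
    have hg : gram M s t = -Real.cos θ := rfl
    have hg' : gram M t s = -Real.cos θ := by rw [gram_symm, hg]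
    have e1 := two_mul_sin_add (k * θ) θ
    have r1 : (k : ℝ) * θ + θ = (k + 1) * θ := by ring
    have r2 : (k : ℝ) * θ + 2 * θ = (((k + 1 : ℕ) : ℝ) + 1) * θ := by push_cast; ring
    rw [r1, r2] at e1
    have e2 : Real.sin ((((k + 1 : ℕ) : ℝ) + 1) * θ) =
      2 * Real.cos θ * Real.sin ((k + 1) * θ) - Real.sin (k * θ) := by linarith
    rw [e2]
    push_cast
    by_cases hk : Even k
    · have hk' : ¬ Even (k + 1) := by simpa [Nat.even_add_one] using hk
      simp only [hk, hk', if_true, if_false, geomRep_simple, map_add, map_smul,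
        simpleRefl_simpleRoot, hg, gram_self]
      module
    · have hk' : Even (k + 1) := by simpa [Nat.even_add_one] using hk
      simp only [hk, hk', if_true, if_false, geomRep_simple, map_add, map_smul,
        simpleRefl_simpleRoot, hg', gram_self]
      module

/-- A group element sends a simple root to a positive root as soon as the length increases. -/
theorem geomRep_simpleRoot_nonneg (hM : ∀ i j, M i j ≠ 0) (w : W) (s : B)
    (hs : cs.length (w * cs.simple s) = cs.length w + 1) :
    0 ≤ geomRep cs w (simpleRoot s) := by
  induction hN : cs.length w using Nat.strong_induction_on generalizing w s with
  | _ N IH =>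
  subst hN
  have inner : ∀ (t : B), s ≠ t → ∀ n k u, cs.length u = n → 1 ≤ k →
      cs.length u + k = cs.length w → w = u * cs.wordProd (alternatingWord s t k) →
      0 ≤ geomRep cs w (simpleRoot s) := by
    intro t hst n
    induction n using Nat.strong_induction_on with
    | _ n ih =>
    intro k u hn hk hlen hw
    have hlt : cs.length u < cs.length w := by omega
    set x := if Even k then s else t with hx
    set y := if Even k then t else s with hy
    rcases cs.length_mul_simple u y with hyu | hyu
    · -- the coset representative is as short as possible
      have hux : cs.length (u * cs.simple x) = cs.length u + 1 := by
        rcases cs.length_mul_simple u x with h | h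
        · exact h
        · exfalso
          obtain ⟨k', rfl⟩ : ∃ k', k = k' + 1 := ⟨k - 1, by omega⟩
          have e : x = if Even k' then t else s := by
            rw [hx]
            by_cases hk' : Even k' <;> simp [Nat.even_add_one, hk']
          rw [alternatingWord_succ', ← e, wordProd_cons, ← mul_assoc] at hw
          have h1 := cs.length_mul_le (u * cs.simple x) (cs.wordProd (alternatingWord s t k'))
          have h2 := cs.length_wordProd_le (alternatingWord s t k')
          rw [← hw] at h1
          rw [length_alternatingWord] at h2
          omega
      have px := IH _ hlt u x hux rfl
      have py := IH _ hlt u y hyu rfl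
      have hkm : k + 1 ≤ M s t := by
        by_contra hcon
        have hred := cs.not_isReduced_alternatingWord t s (m := k + 1) (hM t s)
          (by rw [M.symmetric t s]; omega)
        apply hred
        apply le_antisymm (cs.length_wordProd_le _)
        rw [length_alternatingWord, alternatingWord_succ, wordProd_concat]
        have h1 := cs.length_mul_le u (cs.wordProd (alternatingWord s t k) * cs.simple s)
        rw [← mul_assoc, ← hw, hs] at h1
        omega
      have hm := two_le_of_ne hst (hM s t)
      have hsin := sin_pos_of_two_le hm
      have hmpos : (0 : ℝ) < M s t := by exact_mod_cast (by omega : 0 < M s t)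
      have sin_nonneg : ∀ j : ℕ, j ≤ M s t → 0 ≤ Real.sin (j * (Real.pi / M s t)) := by
        intro j hj
        apply Real.sin_nonneg_of_nonneg_of_le_pi (by positivity)
        have : (j : ℝ) ≤ M s t := by exact_mod_cast hj
        rw [mul_div_assoc', div_le_iff₀ hmpos]
        nlinarith [Real.pi_pos]
      have hval : Real.sin (Real.pi / M s t) • geomRep cs w (simpleRoot s) =
          Real.sin ((k + 1) * (Real.pi / M s t)) • geomRep cs u (simpleRoot x) +
          Real.sin (k * (Real.pi / M s t)) • geomRep cs u (simpleRoot y) := by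
        rw [hw, map_mul, Module.End.mul_apply, ← map_smul, geomRep_alternatingWord, map_add,
          map_smul, map_smul]
      have hnn : 0 ≤ Real.sin (Real.pi / M s t) • geomRep cs w (simpleRoot s) := by
        rw [hval]
        have h1 := sin_nonneg (k + 1) hkm
        push_cast at h1
        exact add_nonneg (smul_nonneg h1 px) (smul_nonneg (sin_nonneg k (by omega)) py)
      exact (smul_nonneg_iff_nonneg_of_pos_left hsin).mp hnn
    · refine ih (cs.length (u * cs.simple y)) (by omega) (k + 1) (u * cs.simple y) rfl (by omega)
        (by omega) ?_
      rw [alternatingWord_succ', wordProd_cons, ← hy, ← mul_assoc,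
        cs.simple_mul_simple_cancel_right, hw]
  by_cases hw1 : w = 1
  · subst hw1
    rw [map_one, Module.End.one_apply]
    exact Pi.single_nonneg.mpr zero_le_one
  obtain ⟨t, ht⟩ := cs.exists_rightDescent_of_ne_one hw1
  rw [isRightDescent_iff] at ht
  have hst : s ≠ t := by rintro rfl; omega
  refine inner t hst _ 1 (w * cs.simple t) rfl le_rfl ht ?_
  simp [alternatingWord]

lemma geomRep_simpleRoot_nonpos (hM : ∀ i j, M i j ≠ 0) (w : W) (s : B)
    (hs : cs.length (w * cs.simple s) + 1 = cs.length w) :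
    geomRep cs w (simpleRoot s) ≤ 0 := by
  have h := geomRep_simpleRoot_nonneg cs hM (w * cs.simple s) s
    (by rw [cs.simple_mul_simple_cancel_right]; omega)
  rw [geomRep_simple_simpleRoot_self] at h
  exact neg_nonneg.mp h

end GeometricRepresentation

section Roots

open CoxeterSystem

variable {B W : Type*} [Group W] [Fintype B] [DecidableEq B] {M : CoxeterMatrix B}

/-- The bilinear form preserved by the geometric representation. -/
noncomputable def form (M : CoxeterMatrix B) (u : B → ℝ) : (B → ℝ) →ₗ[ℝ] ℝ :=
  ∑ i, u i • pair M i

omit [DecidableEq B] in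
lemma form_apply (u v : B → ℝ) : form M u v = ∑ i, u i * pair M i v := by
  simp [form]

omit [DecidableEq B] in
lemma form_symm (u v : B → ℝ) : form M u v = form M v u := by
  simp only [form_apply, pair_apply, Finset.mul_sum]
  rw [Finset.sum_comm]
  refine Finset.sum_congr rfl fun i _ => Finset.sum_congr rfl fun j _ => ?_
  rw [gram_symm]; ring

lemma form_simpleRoot_left (i : B) (v : B → ℝ) : form M (simpleRoot i) v = pair M i v := by
  simp [form_apply, simpleRoot, Pi.single_apply]

lemma form_simpleRoot_right (i : B) (v : B → ℝ) : form M v (simpleRoot i) = pair M i v := by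
  rw [form_symm, form_simpleRoot_left]

lemma form_simpleRefl (i : B) (u v : B → ℝ) :
    form M (simpleRefl M i u) (simpleRefl M i v) = form M u v := by
  rw [simpleRefl_apply i v, map_sub, map_smul, form_simpleRoot_right, form_symm _ v,
    simpleRefl_apply i u, map_sub, map_sub, map_smul, map_smul, form_simpleRoot_right,
    pair_simpleRoot, gram_self, form_symm v u]
  simp only [smul_eq_mul]
  ring

variable (cs : CoxeterSystem M W)

lemma form_geomRep (w : W) (u v : B → ℝ) :
    form M (geomRep cs w u) (geomRep cs w v) = form M u v := by
  induction w using cs.simple_induction_left with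
  | one => simp
  | mul_simple_left w i ih =>
    rw [map_mul, Module.End.mul_apply, Module.End.mul_apply, geomRep_simple, form_simpleRefl, ih]

/-- A root is an image of a simple root under the geometric representation. -/
def IsRoot (β : B → ℝ) : Prop := ∃ w i, β = geomRep cs w (simpleRoot i)

/-- The reflection `t` is the reflection in the root `β`. -/
def IsReflectionIn (t : W) (β : B → ℝ) : Prop :=
  ∃ w i, t = w * cs.simple i * w⁻¹ ∧ β = geomRep cs w (simpleRoot i)

variable {cs}

lemma IsRoot.geomRep_apply {β : B → ℝ} (h : IsRoot cs β) (w : W) :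
    IsRoot cs (geomRep cs w β) := by
  obtain ⟨u, i, rfl⟩ := h
  exact ⟨w * u, i, by rw [map_mul, Module.End.mul_apply]⟩

lemma IsRoot.neg {β : B → ℝ} (h : IsRoot cs β) : IsRoot cs (-β) := by
  obtain ⟨u, i, rfl⟩ := h
  exact ⟨u * cs.simple i, i, by rw [geomRep_simple_simpleRoot_self]⟩

lemma isRoot_simpleRoot (i : B) : IsRoot cs (simpleRoot i) := ⟨1, i, by simp⟩

lemma IsRoot.form_self {β : B → ℝ} (h : IsRoot cs β) : form M β β = 1 := by
  obtain ⟨u, i, rfl⟩ := h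
  rw [form_geomRep, form_simpleRoot_left, pair_simpleRoot, gram_self]

lemma IsRoot.ne_zero {β : B → ℝ} (h : IsRoot cs β) : β ≠ 0 := by
  rintro rfl
  simpa using h.form_self

lemma IsRoot.nonneg_or_nonpos {β : B → ℝ} (h : IsRoot cs β) (hM : ∀ i j, M i j ≠ 0) :
    0 ≤ β ∨ β ≤ 0 := by
  obtain ⟨w, i, rfl⟩ := h
  rcases cs.length_mul_simple w i with h | h
  · exact Or.inl (geomRep_simpleRoot_nonneg cs hM w i h)
  · exact Or.inr (geomRep_simpleRoot_nonpos cs hM w i h)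

lemma IsRoot.not_nonneg_and_nonpos {β : B → ℝ} (h : IsRoot cs β) (h1 : 0 ≤ β) (h2 : β ≤ 0) :
    False :=
  h.ne_zero (le_antisymm h2 h1)

lemma IsRoot.simpleRefl_nonneg {β : B → ℝ} (h : IsRoot cs β) (hM : ∀ i j, M i j ≠ 0)
    (h0 : 0 ≤ β) {i : B} (hi : β ≠ simpleRoot i) : 0 ≤ simpleRefl M i β := by
  have hr := h.geomRep_apply (cs.simple i)
  rw [geomRep_simple] at hr
  rcases hr.nonneg_or_nonpos hM with hr' | hr'
  · exact hr'
  exfalso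
  apply hi
  have hβ : β = β i • simpleRoot i := by
    funext j
    by_cases hj : j = i
    · subst hj; simp [simpleRoot]
    · have h1 := hr' j
      rw [simpleRefl_apply_of_ne hj] at h1
      have h2 := le_antisymm h1 (h0 j)
      simp [simpleRoot, hj, h2]
  have h1 := h.form_self
  have h2 : form M β β = β i * β i := by
    conv_lhs => rw [hβ]
    rw [map_smul, form_simpleRoot_right, map_smul, pair_simpleRoot, gram_self]
    simp
  have h3 := h0 i
  have h4 : β i = 1 := by
    simp only [Pi.zero_apply] at h3
    nlinarith
  rw [hβ, h4, one_smul]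

variable (cs) in
/-- The geometric representation is faithful. -/
lemma geomRep_injective (hM : ∀ i j, M i j ≠ 0) : Function.Injective (geomRep cs) := by
  rw [injective_iff_map_eq_one]
  intro w hw
  by_contra h1
  obtain ⟨i, hi⟩ := cs.exists_rightDescent_of_ne_one h1
  have h := geomRep_simpleRoot_nonpos cs hM w i (cs.isRightDescent_iff.mp hi)
  rw [hw, Module.End.one_apply] at h
  exact (isRoot_simpleRoot (cs := cs) i).not_nonneg_and_nonpos
    (Pi.single_nonneg.mpr zero_le_one) h

lemma IsReflectionIn.isRoot {t : W} {β : B → ℝ} (h : IsReflectionIn cs t β) : IsRoot cs β := by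
  obtain ⟨w, i, -, hβ⟩ := h
  exact ⟨w, i, hβ⟩

lemma IsReflectionIn.isReflection {t : W} {β : B → ℝ} (h : IsReflectionIn cs t β) :
    cs.IsReflection t := by
  obtain ⟨w, i, ht, -⟩ := h
  exact ⟨w, i, ht⟩

lemma isReflectionIn_simple (i : B) : IsReflectionIn cs (cs.simple i) (simpleRoot i) :=
  ⟨1, i, by simp, by simp⟩

lemma IsReflectionIn.conj {t : W} {β : B → ℝ} (h : IsReflectionIn cs t β) (w : W) :
    IsReflectionIn cs (w * t * w⁻¹) (geomRep cs w β) := by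
  obtain ⟨u, i, rfl, rfl⟩ := h
  exact ⟨w * u, i, by group, by rw [map_mul, Module.End.mul_apply]⟩

lemma IsReflectionIn.neg {t : W} {β : B → ℝ} (h : IsReflectionIn cs t β) :
    IsReflectionIn cs t (-β) := by
  obtain ⟨u, i, rfl, rfl⟩ := h
  refine ⟨u * cs.simple i, i, ?_, by rw [geomRep_simple_simpleRoot_self]⟩
  simp [mul_assoc]

lemma IsReflectionIn.geomRep_eq {t : W} {β : B → ℝ} (h : IsReflectionIn cs t β) (v : B → ℝ) :
    geomRep cs t v = v - (2 * form M β v) • β := by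
  obtain ⟨u, i, rfl, rfl⟩ := h
  rw [map_mul, map_mul, Module.End.mul_apply, Module.End.mul_apply, geomRep_simple,
    simpleRefl_apply, map_sub, map_smul, geomRep_self_apply_inv, ← form_simpleRoot_left,
    ← form_geomRep cs u, geomRep_self_apply_inv]

lemma IsReflectionIn.eq {t t' : W} {β : B → ℝ} (hM : ∀ i j, M i j ≠ 0)
    (h : IsReflectionIn cs t β) (h' : IsReflectionIn cs t' β) : t = t' := by
  apply geomRep_injective cs hM
  refine LinearMap.ext fun v => ?_
  rw [h.geomRep_eq, h'.geomRep_eq]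

lemma IsReflectionIn.eq_or_eq_neg {t : W} {β γ : B → ℝ}
    (h : IsReflectionIn cs t β) (h' : IsReflectionIn cs t γ) : γ = β ∨ γ = -β := by
  have h1 : geomRep cs t γ = -γ := by
    rw [h'.geomRep_eq, h'.isRoot.form_self]; module
  rw [h.geomRep_eq] at h1
  have h2 : γ = form M β γ • β := by
    have h3 : (2 : ℝ) • γ = (2 : ℝ) • (form M β γ • β) := by
      rw [smul_smul, ← sub_eq_zero]
      rw [← sub_eq_zero] at h1
      rw [← h1]; module
    exact (smul_right_inj two_ne_zero).mp h3
  have h4 : form M β γ * form M β γ = 1 := by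
    have h5 := congrArg (form M γ) h2
    rw [h'.isRoot.form_self, map_smul, form_symm γ β, smul_eq_mul] at h5
    exact h5.symm
  rcases mul_self_eq_one_iff.mp h4 with h5 | h5
  · left; rw [h2, h5, one_smul]
  · right; rw [h2, h5]; module

lemma exists_isReflectionIn {t : W} (ht : cs.IsReflection t) : ∃ β, IsReflectionIn cs t β := by
  obtain ⟨w, i, rfl⟩ := ht
  exact ⟨_, w, i, rfl, rfl⟩

lemma IsReflectionIn.geomRep_nonneg {t : W} {β : B → ℝ} (hM : ∀ i j, M i j ≠ 0)
    (h : IsReflectionIn cs t β) (h0 : 0 ≤ β) (w : W) (hw : cs.length w < cs.length (w * t)) :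
    0 ≤ geomRep cs w β := by
  induction hN : cs.length w generalizing w with
  | zero =>
    rw [cs.length_eq_zero_iff] at hN
    simpa [hN] using h0
  | succ N ih =>
    have hw1 : w ≠ 1 := by rintro rfl; simp at hN
    obtain ⟨i, hi⟩ := cs.exists_leftDescent_of_ne_one hw1
    rw [isLeftDescent_iff] at hi
    obtain ⟨u, rfl⟩ : ∃ u, w = cs.simple i * u := ⟨cs.simple i * w, by simp⟩
    rw [cs.simple_mul_simple_cancel_left] at hi
    have h1 := cs.length_mul_le (cs.simple i) (u * t)
    rw [cs.length_simple, ← mul_assoc] at h1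
    have h2 := ih u (by omega) (by omega)
    rw [map_mul, Module.End.mul_apply, geomRep_simple]
    apply (h.isRoot.geomRep_apply u).simpleRefl_nonneg hM h2
    intro heq
    have h3 := h.conj u
    rw [heq] at h3
    have h4 := h3.eq hM (isReflectionIn_simple i)
    rw [← h4] at hw
    have h5 : u * t * u⁻¹ * u * t = u := by
      rw [inv_mul_cancel_right, mul_assoc, h.isReflection.mul_self, mul_one]
    rw [h5, h4] at hw
    omega

/-- Right inversions are the reflections in the positive roots that become negative. -/
lemma IsReflectionIn.isRightInversion_iff {t : W} {β : B → ℝ} (hM : ∀ i j, M i j ≠ 0)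
    (h : IsReflectionIn cs t β) (h0 : 0 ≤ β) (w : W) :
    cs.IsRightInversion w t ↔ geomRep cs w β ≤ 0 := by
  constructor
  · rintro ⟨-, hlt⟩
    have h1 := h.geomRep_nonneg hM h0 (w * t)
      (by rwa [mul_assoc, h.isReflection.mul_self, mul_one])
    rw [map_mul, Module.End.mul_apply, h.geomRep_eq, h.isRoot.form_self] at h1
    have h2 : β - (2 * 1 : ℝ) • β = -β := by module
    rw [h2, map_neg] at h1
    exact neg_nonneg.mp h1
  · intro h1
    refine ⟨h.isReflection, ?_⟩
    by_contra hcon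
    have hne := h.isReflection.length_mul_left_ne w
    exact (h.isRoot.geomRep_apply w).not_nonneg_and_nonpos
      (h.geomRep_nonneg hM h0 w (by omega)) h1

variable (cs) in
/-- The positive roots that `w` sends to negative roots. -/
def inversionRoots (w : W) : Set (B → ℝ) := {β | IsRoot cs β ∧ 0 ≤ β ∧ geomRep cs w β ≤ 0}

variable (cs) in
lemma finite_setOf_isRoot [Finite W] : {β | IsRoot cs β}.Finite := by
  refine (Set.finite_range fun p : W × B => geomRep cs p.1 (simpleRoot p.2)).subset ?_
  rintro _ ⟨w, i, rfl⟩
  exact ⟨(w, i), rfl⟩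

variable (cs) in
lemma geomRep_wordProd_apply_of_notMem {l : List B} {j : B} (hj : j ∉ l) (v : B → ℝ) :
    geomRep cs (cs.wordProd l) v j = v j := by
  induction l with
  | nil => simp
  | cons i l ih =>
    rw [List.mem_cons, not_or] at hj
    rw [wordProd_cons, map_mul, Module.End.mul_apply, geomRep_simple, simpleRefl_apply_of_ne hj.1,
      ih hj.2]

variable (cs) in
lemma inversionRoots_wordProd_cons (hM : ∀ i j, M i j ≠ 0) {l : List B} {i : B} (hi : i ∉ l) :
    inversionRoots cs (cs.wordProd (i :: l)) =
      insert (geomRep cs (cs.wordProd l)⁻¹ (simpleRoot i))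
        (inversionRoots cs (cs.wordProd l)) := by
  ext β
  simp only [inversionRoots, Set.mem_insert_iff, Set.mem_ofPred_eq, wordProd_cons, map_mul,
    Module.End.mul_apply, geomRep_simple]
  constructor
  · rintro ⟨hβ, h0, hneg⟩
    rcases (hβ.geomRep_apply (cs.wordProd l)).nonneg_or_nonpos hM with h | h
    · left
      have heq : geomRep cs (cs.wordProd l) β = simpleRoot i := by
        by_contra hne
        have h1 := (hβ.geomRep_apply (cs.wordProd l)).simpleRefl_nonneg hM h hne
        have h2 := (hβ.geomRep_apply (cs.wordProd l)).geomRep_apply (cs.simple i)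
        rw [geomRep_simple] at h2
        exact h2.not_nonneg_and_nonpos h1 hneg
      rw [← heq, geomRep_inv_apply_self]
    · exact Or.inr ⟨hβ, h0, h⟩
  · rintro (rfl | ⟨hβ, h0, hneg⟩)
    · have hr : IsRoot cs (geomRep cs (cs.wordProd l)⁻¹ (simpleRoot i)) :=
        (isRoot_simpleRoot i).geomRep_apply _
      refine ⟨hr, ?_, ?_⟩
      · rcases hr.nonneg_or_nonpos hM with h | h
        · exact h
        · exfalso
          have h1 := h i
          rw [← wordProd_reverse, geomRep_wordProd_apply_of_notMem cs (by simpa using hi)] at h1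
          simp [simpleRoot] at h1
          linarith
      · rw [geomRep_self_apply_inv, simpleRefl_simpleRoot_self, neg_nonpos]
        exact Pi.single_nonneg.mpr zero_le_one
    · refine ⟨hβ, h0, ?_⟩
      have h1 : 0 ≤ simpleRefl M i (-geomRep cs (cs.wordProd l) β) := by
        apply (hβ.geomRep_apply _).neg.simpleRefl_nonneg hM (neg_nonneg.mpr hneg)
        intro heq
        have h2 := congrFun heq i
        rw [Pi.neg_apply, geomRep_wordProd_apply_of_notMem cs hi] at h2
        have h3 := h0 i
        simp [simpleRoot] at h2 h3
        linarith
      rw [map_neg] at h1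
      exact neg_nonneg.mp h1

variable (cs) in
/-- A product of distinct simple reflections has as many inversions as letters. -/
lemma ncard_inversionRoots_wordProd [Finite W] {l : List B} (hl : l.Nodup) :
    (inversionRoots cs (cs.wordProd l)).ncard = l.length := by
  have hM := coxeterMatrix_ne_zero cs
  induction l with
  | nil =>
    rw [List.length_nil, Set.ncard_eq_zero
      ((finite_setOf_isRoot cs).subset fun β h => h.1), Set.eq_empty_iff_forall_notMem]
    rintro β ⟨hβ, h1, h2⟩
    exact hβ.not_nonneg_and_nonpos h1 (by simpa using h2)
  | cons i l ih =>
    rw [List.nodup_cons] at hl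
    rw [inversionRoots_wordProd_cons cs hM hl.1, Set.ncard_insert_of_notMem ?_
      ((finite_setOf_isRoot cs).subset fun β h => h.1), ih hl.2, List.length_cons]
    · rintro ⟨-, -, h⟩
      rw [geomRep_self_apply_inv] at h
      have := h i
      simp [simpleRoot] at this
      linarith

variable (cs) in
lemma sum_geomRep_eq_zero [Fintype W] (v : B → ℝ) : ∑ w : W, geomRep cs w v = 0 := by
  have hs : ∀ i, ∑ w : W, geomRep cs w (simpleRoot i) = 0 := by
    intro i
    have h : ∑ w : W, geomRep cs w (simpleRoot i) = -∑ w : W, geomRep cs w (simpleRoot i) := by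
      rw [← Finset.sum_neg_distrib]
      refine Fintype.sum_equiv (Equiv.mulRight (cs.simple i)) _ _ fun w => ?_
      rw [Equiv.coe_mulRight, geomRep_simple_simpleRoot_self, neg_neg]
    exact self_eq_neg.mp h
  have hv : v = ∑ i, v i • simpleRoot i := by
    funext j
    simp [simpleRoot, Finset.sum_apply, Pi.single_apply]
  rw [hv]
  simp only [map_sum, map_smul]
  rw [Finset.sum_comm]
  refine Finset.sum_eq_zero fun i _ => ?_
  rw [← Finset.smul_sum, hs, smul_zero]

/-- For a finite Coxeter group, a nonnegative antidominant vector vanishes. -/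
lemma eq_zero_of_nonneg_of_pair_nonpos [Finite W] (cs : CoxeterSystem M W) {v : B → ℝ} (h0 : 0 ≤ v)
    (hv : ∀ i, pair M i v ≤ 0) : v = 0 := by
  have hM := coxeterMatrix_ne_zero cs
  have hle : ∀ w : W, v ≤ geomRep cs w v := by
    intro w
    induction hN : cs.length w generalizing w with
    | zero =>
      rw [cs.length_eq_zero_iff] at hN
      simp [hN]
    | succ N ih =>
      have hw1 : w ≠ 1 := by rintro rfl; simp at hN
      obtain ⟨i, hi⟩ := cs.exists_rightDescent_of_ne_one hw1
      rw [isRightDescent_iff] at hi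
      obtain ⟨u, rfl⟩ : ∃ u, w = u * cs.simple i := ⟨w * cs.simple i, by simp⟩
      rw [cs.simple_mul_simple_cancel_right] at hi
      have h1 := ih u (by omega)
      have h2 := geomRep_simpleRoot_nonneg cs hM u i hi.symm
      rw [map_mul, Module.End.mul_apply, geomRep_simple, simpleRefl_apply, map_sub, map_smul]
      have h3 : 0 ≤ (-(2 * pair M i v)) • geomRep cs u (simpleRoot i) :=
        smul_nonneg (by linarith [hv i]) h2
      rw [neg_smul] at h3
      rw [sub_eq_add_neg]
      exact le_add_of_le_of_nonneg h1 h3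
  have := Fintype.ofFinite W
  have hsum := sum_geomRep_eq_zero cs v
  refine le_antisymm (fun j => ?_) h0
  have h1 : ∑ _w : W, v ≤ ∑ w : W, geomRep cs w v := Finset.sum_le_sum fun w _ => hle w
  rw [hsum] at h1
  have h2 := h1 j
  simp only [Finset.sum_const, Finset.card_univ, Pi.smul_apply, nsmul_eq_mul, Pi.zero_apply] at h2
  have h3 : (0 : ℝ) < Fintype.card W := by exact_mod_cast Fintype.card_pos
  rw [Pi.zero_apply]
  by_contra hcon
  push Not at hcon
  have := mul_pos h3 hcon
  linarith

variable (cs) in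
lemma pair_eq_zero_of_geomRep_wordProd_eq {l : List B} (hl : l.Nodup) {v : B → ℝ}
    (hv : geomRep cs (cs.wordProd l) v = v) : ∀ i ∈ l, pair M i v = 0 := by
  induction l with
  | nil => simp
  | cons i l ih =>
    rw [List.nodup_cons] at hl
    rw [wordProd_cons, map_mul, Module.End.mul_apply, geomRep_simple] at hv
    have h1 : geomRep cs (cs.wordProd l) v = simpleRefl M i v := by
      have h0 := congrArg (simpleRefl M i) hv
      rwa [← Module.End.mul_apply, simpleRefl_mul_self, Module.End.one_apply] at h0
    have h2 := congrFun h1 i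
    rw [geomRep_wordProd_apply_of_notMem cs hl.1, simpleRefl_apply_self] at h2
    have h3 : pair M i v = 0 := by linarith
    have h4 : geomRep cs (cs.wordProd l) v = v := by
      rw [h1, simpleRefl_apply, h3]; simp
    intro j hj
    rcases List.mem_cons.mp hj with rfl | hj
    · exact h3
    · exact ih hl.2 h4 j hj

variable (cs) in
/-- Every orbit of a Coxeter element on the roots passes from positive to negative. -/
lemma exists_pow_mem_inversionRoots [Finite W] {l : List B} (hl : l.Nodup) (hmem : ∀ i, i ∈ l)
    {β : B → ℝ} (hβ : IsRoot cs β) :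
    ∃ k < orderOf (cs.wordProd l),
      geomRep cs (cs.wordProd l ^ k) β ∈ inversionRoots cs (cs.wordProd l) := by
  have hM := coxeterMatrix_ne_zero cs
  set c := cs.wordProd l with hc
  have hpos := orderOf_pos c
  by_contra hcon
  push Not at hcon
  have hroot : ∀ k : ℕ, IsRoot cs (geomRep cs (c ^ k) β) := fun k => hβ.geomRep_apply _
  have hstep : ∀ k : ℕ, 0 ≤ geomRep cs (c ^ k) β → 0 ≤ geomRep cs (c ^ (k + 1)) β := by
    intro k hk
    have h1 := hcon (k % orderOf c) (Nat.mod_lt _ hpos)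
    rw [pow_mod_orderOf] at h1
    rcases (hroot (k + 1)).nonneg_or_nonpos hM with h | h
    · exact h
    · exact absurd ⟨hroot k, hk, by rwa [← Module.End.mul_apply, ← map_mul, ← pow_succ']⟩ h1
  set v := ∑ k ∈ Finset.range (orderOf c), geomRep cs (c ^ k) β with hv
  have hfix : geomRep cs c v = v := by
    have h1 : geomRep cs c v = ∑ k ∈ Finset.range (orderOf c), geomRep cs (c ^ (k + 1)) β := by
      rw [hv, map_sum]
      refine Finset.sum_congr rfl fun k _ => ?_
      rw [pow_succ', map_mul, Module.End.mul_apply]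
    have h2 := Finset.sum_range_succ (fun k => geomRep cs (c ^ k) β) (orderOf c)
    rw [Finset.sum_range_succ', pow_orderOf_eq_one, pow_zero] at h2
    rw [h1, hv]
    exact add_right_cancel h2
  have hpair : ∀ i, pair M i v = 0 := fun i =>
    pair_eq_zero_of_geomRep_wordProd_eq cs hl hfix i (hmem i)
  by_cases hall : ∃ k0 : ℕ, 0 ≤ geomRep cs (c ^ k0) β
  · obtain ⟨k0, hk0⟩ := hall
    have h1 : ∀ k ≥ k0, 0 ≤ geomRep cs (c ^ k) β := fun k hk =>
      Nat.le_induction hk0 (fun k _ h => hstep k h) k hk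
    have h2 : ∀ k, 0 ≤ geomRep cs (c ^ k) β := by
      intro k
      have h3 := h1 (k + orderOf c * k0) (by nlinarith)
      rwa [pow_add, pow_mul, pow_orderOf_eq_one, one_pow, mul_one] at h3
    have h3 : v = 0 := eq_zero_of_nonneg_of_pair_nonpos cs (Finset.sum_nonneg fun k _ => h2 k)
      fun i => (hpair i).le
    rw [hv, Finset.sum_eq_zero_iff_of_nonneg fun k _ => h2 k] at h3
    exact (hroot 0).ne_zero (h3 0 (Finset.mem_range.mpr hpos))
  · push Not at hall
    have h2 : ∀ k, 0 ≤ -geomRep cs (c ^ k) β := fun k =>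
      neg_nonneg.mpr (((hroot k).nonneg_or_nonpos hM).resolve_left (hall k))
    have h3 : -v = 0 := by
      apply eq_zero_of_nonneg_of_pair_nonpos cs
      · rw [hv, ← Finset.sum_neg_distrib]
        exact Finset.sum_nonneg fun k _ => h2 k
      · intro i
        rw [map_neg, hpair i, neg_zero]
    rw [hv, ← Finset.sum_neg_distrib, Finset.sum_eq_zero_iff_of_nonneg fun k _ => h2 k] at h3
    exact (hroot 0).ne_zero (neg_eq_zero.mp (h3 0 (Finset.mem_range.mpr hpos)))

end Roots

section CoxeterGraph

open CoxeterSystem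

variable {B W : Type*} [Group W] {M : CoxeterMatrix B}

lemma gram_le_neg_half {i j : B} (hij : i ≠ j) (h2 : M i j ≠ 2) : gram M i j ≤ -(1 / 2) := by
  have h1 := M.off_diagonal i j hij
  unfold gram
  rw [neg_le_neg_iff]
  by_cases h0 : M i j = 0
  · simp [h0]; norm_num
  have h3 : (3 : ℝ) ≤ M i j := by exact_mod_cast (by omega : 3 ≤ M i j)
  rw [← Real.cos_pi_div_three]
  have hpi := Real.pi_pos
  apply Real.cos_le_cos_of_nonneg_of_le_pi (by positivity) (by linarith)
  gcongr

lemma gram_eq_zero {i j : B} (h2 : M i j = 2) : gram M i j = 0 := by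
  simp [gram, h2]

lemma gram_nonpos {i j : B} (hij : i ≠ j) : gram M i j ≤ 0 := by
  by_cases h2 : M i j = 2
  · rw [gram_eq_zero h2]
  · linarith [gram_le_neg_half hij h2]

/-- The Coxeter graph of a finite Coxeter group is a forest: every nonempty set of vertices
contains a vertex with at most one neighbour in the set. -/
lemma exists_leaf [Fintype B] [DecidableEq B] [Finite W] (cs : CoxeterSystem M W) {S : Finset B}
    (hS : S.Nonempty) :
    ∃ i ∈ S, ∀ a ∈ S, ∀ b ∈ S, a ≠ i → b ≠ i → M i a ≠ 2 → M i b ≠ 2 → a = b := by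
  by_contra hcon
  push Not at hcon
  have hv : ∀ i, pair M i (fun j => if j ∈ S then (1 : ℝ) else 0) ≤ 0 := by
    intro i
    have he : pair M i (fun j => if j ∈ S then (1 : ℝ) else 0) = ∑ j ∈ S, gram M j i := by
      simp [pair_apply]
    rw [he]
    by_cases hi : i ∈ S
    · obtain ⟨a, ha, b, hb, hai, hbi, ha2, hb2, hab⟩ := hcon i hi
      have hsub : ({i, a, b} : Finset B) ⊆ S := by
        intro x hx
        simp only [Finset.mem_insert, Finset.mem_singleton] at hx
        rcases hx with rfl | rfl | rfl <;> assumption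
      rw [← Finset.sum_sdiff hsub, Finset.sum_insert (by simp [hai.symm, hbi.symm]),
        Finset.sum_pair hab, gram_self]
      have h1 := gram_le_neg_half hai.symm ha2
      have h2 := gram_le_neg_half hbi.symm hb2
      rw [gram_symm] at h1 h2
      have h3 : ∑ j ∈ S \ {i, a, b}, gram M j i ≤ 0 := by
        refine Finset.sum_nonpos fun j hj => gram_nonpos ?_
        rintro rfl
        simp at hj
      linarith
    · refine Finset.sum_nonpos fun j hj => gram_nonpos ?_
      rintro rfl
      exact hi hj
  have h0 := eq_zero_of_nonneg_of_pair_nonpos cs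
    (v := fun j => if j ∈ S then (1 : ℝ) else 0) (fun j => by dsimp; split_ifs <;> simp) hv
  obtain ⟨i, hi⟩ := hS
  have := congrFun h0 i
  simp [hi] at this

/-- The equivalence relation on words generated by rotations and by exchanging two commuting
letters. -/
inductive WordConj (M : CoxeterMatrix B) : List B → List B → Prop
  | refl (l) : WordConj M l l
  | symm {l l'} : WordConj M l l' → WordConj M l' l
  | trans {l l' l''} : WordConj M l l' → WordConj M l' l'' → WordConj M l l''
  | rotate (a l) : WordConj M (a :: l) (l ++ [a])
  | swap (a b l) : M a b = 2 → WordConj M (a :: b :: l) (b :: a :: l)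

namespace WordConj

lemma perm {l l' : List B} (h : WordConj M l l') : l.Perm l' := by
  induction h with
  | refl l => exact .refl l
  | symm _ ih => exact ih.symm
  | trans _ _ ih1 ih2 => exact ih1.trans ih2
  | rotate a l => exact (List.perm_append_singleton a l).symm
  | swap a b l _ => exact .swap b a l

lemma isConj (cs : CoxeterSystem M W) {l l' : List B} (h : WordConj M l l') :
    IsConj (cs.wordProd l) (cs.wordProd l') := by
  induction h with
  | refl l => exact IsConj.refl _
  | symm _ ih => exact ih.symm
  | trans _ _ ih1 ih2 => exact ih1.trans ih2
  | rotate a l =>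
    rw [isConj_iff]
    refine ⟨(cs.simple a)⁻¹, ?_⟩
    rw [wordProd_cons, wordProd_append, wordProd_singleton]
    group
  | swap a b l hab =>
    have h := cs.simple_mul_simple_pow a b
    rw [hab, pow_two] at h
    have h' : cs.simple a * cs.simple b = cs.simple b * cs.simple a := by
      rw [eq_comm, ← mul_left_inj (cs.simple a * cs.simple b), h]
      simp [mul_assoc]
    rw [wordProd_cons, wordProd_cons, wordProd_cons, wordProd_cons, ← mul_assoc, h', mul_assoc]

lemma append_comm (u v : List B) : WordConj M (u ++ v) (v ++ u) := by
  induction u generalizing v with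
  | nil => simpa using refl v
  | cons a u ih =>
    have h1 : WordConj M (a :: (u ++ v)) (u ++ (v ++ [a])) := by
      simpa using rotate (M := M) a (u ++ v)
    have h2 := ih (v ++ [a])
    simpa using h1.trans h2

lemma swap_middle (p : List B) {a b : B} (l : List B) (h : M a b = 2) :
    WordConj M (p ++ a :: b :: l) (p ++ b :: a :: l) := by
  refine (append_comm p _).trans (WordConj.trans ?_ (append_comm _ p))
  exact swap a b (l ++ p) h

lemma move_right (p u v : List B) {i : B} (h : ∀ a ∈ u, M i a = 2) :
    WordConj M (p ++ i :: (u ++ v)) (p ++ u ++ i :: v) := by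
  induction u generalizing p with
  | nil => simpa using refl _
  | cons a u ih =>
    have h1 : WordConj M (p ++ i :: a :: (u ++ v)) (p ++ a :: i :: (u ++ v)) :=
      swap_middle p _ (h a (by simp))
    have h2 := ih (p ++ [a]) fun b hb => h b (by simp [hb])
    refine h1.trans ?_
    simpa using h2

lemma cons {l l' : List B} (h : WordConj M l l') {i : B} (hn : l.Nodup)
    (hleaf : ∀ a ∈ l, ∀ b ∈ l, M i a ≠ 2 → M i b ≠ 2 → a = b) :
    WordConj M (i :: l) (i :: l') := by
  induction h with
  | refl l => exact refl _
  | @symm l l' h ih =>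
    refine (ih (h.perm.nodup_iff.mpr hn) fun a ha b hb => ?_).symm
    exact hleaf a (h.perm.mem_iff.mp ha) b (h.perm.mem_iff.mp hb)
  | @trans l l' l'' h1 h2 ih1 ih2 =>
    refine (ih1 hn hleaf).trans (ih2 (h1.perm.nodup_iff.mp hn) fun a ha b hb => ?_)
    exact hleaf a (h1.perm.mem_iff.mpr ha) b (h1.perm.mem_iff.mpr hb)
  | rotate a l =>
    by_cases ha : M i a = 2
    · exact (swap i a l ha).trans (rotate a (i :: l))
    · have hcomm : ∀ b ∈ l, M i b = 2 := by
        intro b hb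
        by_contra hb2
        have hab := hleaf a (by simp) b (by simp [hb]) ha hb2
        rw [List.nodup_cons] at hn
        exact hn.1 (hab ▸ hb)
      have h1 : WordConj M (i :: a :: l) (a :: l ++ [i]) := rotate i (a :: l)
      have h2 : WordConj M (a :: i :: l) (a :: l ++ [i]) := by
        simpa using move_right [a] l [] hcomm
      exact (h1.trans h2.symm).trans (rotate a (i :: l))
  | swap a b l hab => exact swap_middle [i] l hab

end WordConj

/-- In a finite Coxeter group, any two orderings of a set of simple reflections are related by
rotations and commutations. -/
lemma wordConj_of_perm [Fintype B] [DecidableEq B] [Finite W] (cs : CoxeterSystem M W)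
    {l l' : List B} (hl : l.Nodup) (hp : l.Perm l') : WordConj M l l' := by
  induction hn : l.length generalizing l l' with
  | zero =>
    rw [List.length_eq_zero_iff] at hn
    subst hn
    rw [List.nil_perm.mp hp]
    exact .refl _
  | succ n ih =>
    have hne : l.toFinset.Nonempty := by
      rw [List.toFinset_nonempty_iff]
      rintro rfl
      simp at hn
    obtain ⟨i, hi, hleaf⟩ := exists_leaf cs hne
    simp only [List.mem_toFinset] at hi hleaf
    obtain ⟨p, q, rfl⟩ := List.append_of_mem hi
    obtain ⟨p', q', rfl⟩ := List.append_of_mem (hp.mem_iff.mp hi)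
    have h1 : WordConj M (p ++ i :: q) (i :: (q ++ p)) := WordConj.append_comm p (i :: q)
    have h2 : WordConj M (p' ++ i :: q') (i :: (q' ++ p')) := WordConj.append_comm p' (i :: q')
    have hn1 := h1.perm.nodup_iff.mp hl
    have hperm : (q ++ p).Perm (q' ++ p') :=
      ((h1.perm.symm.trans hp).trans h2.perm).cons_inv
    rw [List.nodup_cons] at hn1
    have h3 := ih hn1.2 hperm (by simp at hn ⊢; omega)
    refine (h1.trans (h3.cons hn1.2 fun a ha b hb => ?_)).trans h2.symm
    refine hleaf a (h1.perm.mem_iff.mpr (by simp [ha])) b (h1.perm.mem_iff.mpr (by simp [hb])) ?_ ?_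
    · rintro rfl; exact hn1.1 ha
    · rintro rfl; exact hn1.1 hb

/-- The Coxeter graph of a finite Coxeter group is bipartite. -/
lemma exists_coloring [Fintype B] [DecidableEq B] [Finite W] (cs : CoxeterSystem M W) (i₀ : B) :
    ∃ ε : B → Bool, ε i₀ = true ∧ ∀ i j, i ≠ j → M i j ≠ 2 → ε i ≠ ε j := by
  have h : ∀ S : Finset B, ∃ ε : B → Bool, ∀ i ∈ S, ∀ j ∈ S, i ≠ j → M i j ≠ 2 → ε i ≠ ε j := by
    intro S
    induction S using Finset.strongInduction with
    | H S ih =>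
    rcases S.eq_empty_or_nonempty with rfl | hS
    · exact ⟨fun _ => true, by simp⟩
    obtain ⟨i, hi, hleaf⟩ := exists_leaf cs hS
    obtain ⟨ε, hε⟩ := ih (S.erase i) (Finset.erase_ssubset hi)
    obtain ⟨e, he⟩ : ∃ e : Bool, ∀ a ∈ S, a ≠ i → M i a ≠ 2 → e ≠ ε a := by
      by_cases h : ∃ a ∈ S, a ≠ i ∧ M i a ≠ 2
      · obtain ⟨a, ha, hai, ha2⟩ := h
        refine ⟨!ε a, fun b hb hbi hb2 => ?_⟩
        rw [hleaf b hb a ha hbi hai hb2 ha2]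
        simp
      · push Not at h
        exact ⟨true, fun a ha hai ha2 => absurd (h a ha hai) ha2⟩
    refine ⟨Function.update ε i e, fun a ha b hb hab h2 => ?_⟩
    by_cases hai : a = i
    · subst hai
      rw [Function.update_self, Function.update_of_ne hab.symm]
      exact he b hb hab.symm h2
    · rw [Function.update_of_ne hai]
      by_cases hbi : b = i
      · subst hbi
        rw [Function.update_self]
        exact (he a ha hai (by rwa [M.symmetric])).symm
      · rw [Function.update_of_ne hbi]
        exact hε a (by simp [ha, hai]) b (by simp [hb, hbi]) hab h2
  obtain ⟨ε, hε⟩ := h Finset.univ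
  refine ⟨fun i => ε i == ε i₀, by simp, fun i j hij h2 heq => ?_⟩
  have hne := hε i (Finset.mem_univ _) j (Finset.mem_univ _) hij h2
  dsimp only at heq
  generalize ε i = a at *
  generalize ε j = b at *
  generalize ε i₀ = d at *
  revert heq hne
  cases a <;> cases b <;> cases d <;> simp

/-- A Perron–Frobenius eigenvector of the Gram matrix of an irreducible finite Coxeter group. -/
lemma exists_pos_eigenvector [Fintype B] [DecidableEq B] [Nonempty B] [Finite W]
    (cs : CoxeterSystem M W)
    (hirr : ∀ J : Finset B, (∀ i ∈ J, ∀ j ∉ J, M i j = 2) → J = ∅ ∨ J = Finset.univ) :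
    ∃ (x : B → ℝ) (μ : ℝ), (∀ i, 0 < x i) ∧ 0 < μ ∧ μ ≤ 1 ∧ ∀ i, pair M i x = μ * x i := by
  set K : Set (B → ℝ) := {v | ∑ i, v i ^ 2 = 1} with hK
  have hKc : IsCompact K := by
    apply Metric.isCompact_of_isClosed_isBounded
    · exact isClosed_eq (by fun_prop) continuous_const
    · refine (Metric.isBounded_iff_subset_closedBall 0).mpr ⟨1, fun v hv => ?_⟩
      rw [mem_closedBall_zero_iff, pi_norm_le_iff_of_nonneg zero_le_one]
      intro i
      rw [Real.norm_eq_abs, ← sq_le_one_iff_abs_le_one]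
      have h1 : v i ^ 2 ≤ ∑ j, v j ^ 2 :=
        Finset.single_le_sum (f := fun j => v j ^ 2) (fun j _ => sq_nonneg _) (Finset.mem_univ i)
      have h2 : ∑ i, v i ^ 2 = 1 := hv
      linarith
  have hKne : K.Nonempty := by
    obtain ⟨i⟩ := ‹Nonempty B›
    exact ⟨simpleRoot i, by simp [hK, simpleRoot, Pi.single_apply]⟩
  have hcont : Continuous fun v : B → ℝ => form M v v := by
    simp only [form_apply, pair_apply]
    fun_prop
  obtain ⟨x, hxK, hxmin⟩ := hKc.exists_isMinOn hKne hcont.continuousOn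
  set μ := form M x x with hμ
  have hmin : ∀ v ∈ K, μ ≤ form M v v := fun v hv => hxmin hv
  have hQ : ∀ v : B → ℝ, 0 ≤ form M v v - μ * ∑ i, v i ^ 2 := by
    intro v
    rcases (Finset.sum_nonneg fun i (_ : i ∈ Finset.univ) => sq_nonneg (v i)).eq_or_lt with h | h
    · have hv : v = 0 := by
        funext i
        have := (Finset.sum_eq_zero_iff_of_nonneg fun i _ => sq_nonneg (v i)).mp h.symm i
          (Finset.mem_univ i)
        simpa using this
      simp [hv]
    · set r := ∑ i, v i ^ 2 with hr
      have hs : Real.sqrt r ^ 2 = r := Real.sq_sqrt h.le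
      have hsp : 0 < Real.sqrt r := Real.sqrt_pos.mpr h
      have h1 := hmin ((Real.sqrt r)⁻¹ • v) (by
        simp only [hK, Set.mem_ofPred_eq, Pi.smul_apply, smul_eq_mul, mul_pow]
        rw [← Finset.mul_sum, ← hr, inv_pow, hs, inv_mul_cancel₀ h.ne'])
      rw [map_smul, form_symm, map_smul, smul_eq_mul, smul_eq_mul, ← mul_assoc, ← sq, inv_pow, hs,
        inv_mul_eq_div, le_div_iff₀ h] at h1
      linarith
  set y : B → ℝ := fun i => |x i| with hy
  have hy0 : ∀ i, 0 ≤ y i := fun i => abs_nonneg _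
  have hyK : ∑ i, y i ^ 2 = 1 := by
    have : ∑ i, x i ^ 2 = 1 := hxK
    simpa [hy] using this
  have hyQ : form M y y ≤ μ := by
    rw [hμ]
    simp only [form_apply, pair_apply, Finset.mul_sum]
    refine Finset.sum_le_sum fun i _ => Finset.sum_le_sum fun j _ => ?_
    by_cases hij : j = i
    · subst hij
      rw [gram_self, mul_one, mul_one]
      simp [hy]
    · have h1 := gram_nonpos (M := M) hij
      have h2 : x i * x j ≤ |x i| * |x j| := by rw [← abs_mul]; exact le_abs_self _
      simp only [hy]
      nlinarith
  have heig : ∀ i, pair M i y = μ * y i := by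
    intro i
    have h : ∀ t : ℝ, 0 ≤ 2 * t * (pair M i y - μ * y i) + t ^ 2 * (1 - μ) := by
      intro t
      have h1 := hQ (y + t • simpleRoot i)
      have h2 : ∑ j, (y + t • simpleRoot i) j ^ 2 = 1 + 2 * t * y i + t ^ 2 := by
        have : ∀ j, (y + t • simpleRoot i) j ^ 2 =
            y j ^ 2 + (if j = i then 2 * t * y i + t ^ 2 else 0) := by
          intro j
          by_cases hj : j = i
          · subst hj; simp [simpleRoot]; ring
          · simp [simpleRoot, hj]
        rw [Finset.sum_congr rfl fun j _ => this j, Finset.sum_add_distrib, hyK]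
        simp; ring
      have h3 : form M (y + t • simpleRoot i) (y + t • simpleRoot i) =
          form M y y + 2 * t * pair M i y + t ^ 2 := by
        rw [map_add, map_smul, form_simpleRoot_right, form_symm, map_add, map_smul,
          form_simpleRoot_right, map_add, map_smul, pair_simpleRoot, gram_self]
        simp only [smul_eq_mul]
        ring
      rw [h2, h3] at h1
      nlinarith
    set b := pair M i y - μ * y i with hb
    have hb0 : b = 0 := by
      have hq : 0 ≤ 1 - μ := by
        have := hQ (simpleRoot i)
        rw [form_simpleRoot_left, pair_simpleRoot, gram_self] at this
        simpa [simpleRoot, Pi.single_apply] using this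
      have h1 := h (-b / (2 - μ))
      have h2 : 0 < 2 - μ := by linarith
      have h3 : 2 * (-b / (2 - μ)) * b + (-b / (2 - μ)) ^ 2 * (1 - μ) =
          -(b ^ 2 * (3 - μ)) / (2 - μ) ^ 2 := by field_simp; ring
      rw [h3, div_nonneg_iff] at h1
      rcases h1 with ⟨h1, -⟩ | ⟨-, h1⟩
      · have : b ^ 2 = 0 := by nlinarith [sq_nonneg b]
        simpa using this
      · nlinarith
    linarith
  have hyne : y ≠ 0 := by
    intro h
    rw [h] at hyK
    simp at hyK
  have hypos : ∀ i, 0 < y i := by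
    have h1 := hirr (Finset.univ.filter fun i => 0 < y i) (by
      intro i hi j hj
      simp only [Finset.mem_filter, Finset.mem_univ, true_and, not_lt] at hi hj
      have hj0 : y j = 0 := le_antisymm hj (hy0 j)
      have h2 := heig j
      rw [hj0, mul_zero, pair_apply] at h2
      have h3 : ∀ k ∈ Finset.univ, y k * gram M k j ≤ 0 := by
        intro k _
        by_cases hk : k = j
        · rw [hk, hj0, zero_mul]
        · exact mul_nonpos_of_nonneg_of_nonpos (hy0 k) (gram_nonpos hk)
      rw [Finset.sum_eq_zero_iff_of_nonpos h3] at h2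
      have h4 := h2 i (Finset.mem_univ i)
      have hij : i ≠ j := by rintro rfl; linarith
      by_contra hcon
      have h5 := gram_le_neg_half hij hcon
      nlinarith)
    rcases h1 with h1 | h1
    · exfalso
      apply hyne
      funext i
      have h2 : i ∉ Finset.univ.filter fun i => 0 < y i := by rw [h1]; simp
      simp only [Finset.mem_filter, Finset.mem_univ, true_and, not_lt] at h2
      exact le_antisymm h2 (hy0 i)
    · intro i
      have h2 : i ∈ Finset.univ.filter fun i => 0 < y i := by rw [h1]; simp
      simpa using h2
  refine ⟨y, μ, hypos, ?_, ?_, heig⟩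
  · by_contra hcon
    push Not at hcon
    exact hyne (eq_zero_of_nonneg_of_pair_nonpos cs hy0 fun i => by
      rw [heig]; exact mul_nonpos_of_nonpos_of_nonneg hcon (hy0 i))
  · obtain ⟨i⟩ := ‹Nonempty B›
    have := hQ (simpleRoot i)
    rw [form_simpleRoot_left, pair_simpleRoot, gram_self] at this
    simpa [simpleRoot, Pi.single_apply] using this

end CoxeterGraph

section Trigonometry

lemma sin_mul_eq_of_recurrence {θ : ℝ} {a b : ℕ → ℝ}
    (hb : ∀ k, b (k + 1) = -b k + 2 * Real.cos θ * a k)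
    (ha : ∀ k, a (k + 1) = -a k + 2 * Real.cos θ * b (k + 1)) (k : ℕ) :
    a k * Real.sin θ = a 0 * Real.sin ((2 * k + 1) * θ) - b 0 * Real.sin (2 * k * θ) ∧
      b k * Real.sin θ = a 0 * Real.sin (2 * k * θ) - b 0 * Real.sin ((2 * k - 1) * θ) := by
  induction k with
  | zero => simp
  | succ k ih =>
    obtain ⟨ih1, ih2⟩ := ih
    have h0 := two_mul_sin_add ((2 * k - 1) * θ) θ
    have h1 := two_mul_sin_add (2 * k * θ) θ
    have h2 := two_mul_sin_add ((2 * k + 1) * θ) θ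
    push_cast
    rw [show (2 * (k : ℝ) - 1) * θ + θ = 2 * k * θ by ring,
      show (2 * (k : ℝ) - 1) * θ + 2 * θ = (2 * k + 1) * θ by ring] at h0
    rw [show 2 * (k : ℝ) * θ + θ = (2 * k + 1) * θ by ring,
      show 2 * (k : ℝ) * θ + 2 * θ = (2 * (k + 1)) * θ by ring] at h1
    rw [show (2 * (k : ℝ) + 1) * θ + θ = (2 * (k + 1)) * θ by ring,
      show (2 * (k : ℝ) + 1) * θ + 2 * θ = (2 * (k + 1) + 1) * θ by ring] at h2
    rw [show (2 * ((k : ℝ) + 1) - 1) * θ = (2 * k + 1) * θ by ring]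
    have hb' : b (k + 1) * Real.sin θ =
        a 0 * Real.sin (2 * (k + 1) * θ) - b 0 * Real.sin ((2 * k + 1) * θ) := by
      rw [hb k]
      linear_combination 2 * Real.cos θ * ih1 - ih2 + a 0 * h1 - b 0 * h0
    refine ⟨?_, hb'⟩
    rw [ha k]
    linear_combination 2 * Real.cos θ * hb' - ih1 + a 0 * h2 - b 0 * h1

lemma exists_mul_eq_pi {θ : ℝ} (h0 : 0 < θ) (h1 : θ ≤ Real.pi / 2)
    (h : ∀ n : ℕ, 0 ≤ Real.sin (n * θ) * Real.sin ((n + 1) * θ)) :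
    ∃ m : ℕ, 2 ≤ m ∧ m * θ = Real.pi := by
  have hpi := Real.pi_pos
  have hex : ∃ m : ℕ, Real.pi ≤ m * θ := by
    obtain ⟨m, hm⟩ := exists_nat_ge (Real.pi / θ)
    exact ⟨m, by rwa [div_le_iff₀ h0] at hm⟩
  classical
  set m := Nat.find hex with hm
  have hspec : Real.pi ≤ m * θ := Nat.find_spec hex
  have hm2 : 2 ≤ m := by
    by_contra hlt
    have : (m : ℝ) ≤ 1 := by exact_mod_cast (by omega : m ≤ 1)
    nlinarith
  obtain ⟨n, hn⟩ : ∃ n, m = n + 1 := ⟨m - 1, by omega⟩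
  have hlt : n * θ < Real.pi := by
    have := Nat.find_min hex (m := n) (by omega)
    linarith
  have hn1 : (1 : ℝ) ≤ n := by exact_mod_cast (by omega : 1 ≤ n)
  refine ⟨m, hm2, ?_⟩
  rw [hn] at hspec ⊢
  push_cast at hspec ⊢
  by_contra hne
  have hgt : Real.pi < (n + 1) * θ := lt_of_le_of_ne hspec (Ne.symm hne)
  have hs1 : 0 < Real.sin (n * θ) := Real.sin_pos_of_pos_of_lt_pi (by nlinarith) hlt
  have hs2 : 0 < Real.sin ((n + 1) * θ - Real.pi) :=
    Real.sin_pos_of_pos_of_lt_pi (by linarith) (by nlinarith)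
  rw [Real.sin_sub_pi] at hs2
  nlinarith [h n]

lemma no_second_descent {θ : ℝ} {m : ℕ} (h0 : 0 < θ) (hm2 : 2 ≤ m) (hm : m * θ = Real.pi)
    {F : ℕ → ℝ} (hF : ∀ k, F (k + 2) = 2 * Real.cos (2 * θ) * F (k + 1) - F k)
    (hF0 : 0 < F 0) (hF1 : F 1 < 0) {k : ℕ} (hk0 : 0 < k) (hkm : k < m) (hk : 0 < F k) :
    0 ≤ F (k + 1) := by
  have hclosed : ∀ k, F k * Real.sin (2 * θ) =
      F 1 * Real.sin (2 * k * θ) - F 0 * Real.sin ((2 * k - 2) * θ) ∧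
      F (k + 1) * Real.sin (2 * θ) =
      F 1 * Real.sin ((2 * k + 2) * θ) - F 0 * Real.sin (2 * k * θ) := by
    intro k
    induction k with
    | zero => simp [neg_mul]
    | succ k ih =>
      obtain ⟨ih1, ih2⟩ := ih
      have h1 := two_mul_sin_add ((2 * k - 2) * θ) (2 * θ)
      have h2 := two_mul_sin_add (2 * k * θ) (2 * θ)
      push_cast
      rw [show (2 * (k : ℝ) - 2) * θ + 2 * θ = 2 * k * θ by ring,
        show (2 * (k : ℝ) - 2) * θ + 2 * (2 * θ) = (2 * k + 2) * θ by ring] at h1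
      rw [show (2 * (k : ℝ)) * θ + 2 * θ = (2 * k + 2) * θ by ring,
        show (2 * (k : ℝ)) * θ + 2 * (2 * θ) = (2 * (k + 1) + 2) * θ by ring] at h2
      rw [show (2 * ((k : ℝ) + 1) - 2) * θ = 2 * k * θ by ring,
        show 2 * ((k : ℝ) + 1) * θ = (2 * k + 2) * θ by ring]
      refine ⟨ih2, ?_⟩
      rw [hF k]
      linear_combination 2 * Real.cos (2 * θ) * ih2 - ih1 + F 1 * h2 - F 0 * h1
  have hpi := Real.pi_pos
  rcases hm2.eq_or_lt with rfl | hm3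
  · obtain rfl : k = 1 := by omega
    linarith
  have hm3' : (3 : ℝ) ≤ m := by exact_mod_cast hm3
  have hk1 : (1 : ℝ) ≤ k := by exact_mod_cast hk0
  have hkm' : (k : ℝ) + 1 ≤ m := by exact_mod_cast hkm
  have hs : 0 < Real.sin (2 * θ) := Real.sin_pos_of_pos_of_lt_pi (by linarith) (by nlinarith)
  obtain ⟨hc1, hc2⟩ := hclosed k
  by_cases hle : 2 * k * θ ≤ Real.pi
  · have h1 : 0 ≤ Real.sin (2 * k * θ) :=
      Real.sin_nonneg_of_nonneg_of_le_pi (by positivity) hle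
    have h2 : 0 ≤ Real.sin ((2 * k - 2) * θ) :=
      Real.sin_nonneg_of_nonneg_of_le_pi (mul_nonneg (by linarith) h0.le) (by nlinarith)
    nlinarith [mul_pos hk hs, mul_nonneg hF0.le h2, mul_nonneg (neg_nonneg.mpr hF1.le) h1]
  · push Not at hle
    have hub : (2 * k + 2) * θ ≤ 2 * Real.pi := by nlinarith
    have h1 : 0 ≤ Real.sin (2 * k * θ - Real.pi) :=
      Real.sin_nonneg_of_nonneg_of_le_pi (by linarith) (by nlinarith)
    have h2 : 0 ≤ Real.sin ((2 * k + 2) * θ - Real.pi) :=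
      Real.sin_nonneg_of_nonneg_of_le_pi (by nlinarith) (by linarith)
    rw [Real.sin_sub_pi] at h1 h2
    by_contra hneg
    push Not at hneg
    nlinarith [mul_neg_of_neg_of_pos hneg hs, mul_nonneg hF0.le h1,
      mul_nonneg (neg_nonneg.mpr hF1.le) h2]

end Trigonometry

section Bipartite

open CoxeterSystem

variable {B W : Type*} [Group W] [Fintype B] [DecidableEq B] {M : CoxeterMatrix B}
  (cs : CoxeterSystem M W)

/-- The action of a product of pairwise commuting simple reflections. -/
lemma geomRep_wordProd_apply_of_commute {l : List B} (hl : l.Nodup)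
    (hcomm : ∀ i ∈ l, ∀ j ∈ l, i ≠ j → M i j = 2) (v : B → ℝ) {j : B} (hj : j ∈ l) :
    geomRep cs (cs.wordProd l) v j = v j - 2 * pair M j v := by
  induction l with
  | nil => simp at hj
  | cons i l ih =>
    rw [List.nodup_cons] at hl
    have ih' := ih hl.2 fun a ha b hb => hcomm a (by simp [ha]) b (by simp [hb])
    rw [wordProd_cons, map_mul, Module.End.mul_apply, geomRep_simple]
    by_cases hji : j = i
    · subst hji
      rw [simpleRefl_apply_self, geomRep_wordProd_apply_of_notMem cs hl.1]
      congr 2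
      rw [pair_apply, pair_apply]
      refine Finset.sum_congr rfl fun k _ => ?_
      by_cases hk : k ∈ l
      · have hkj : k ≠ j := fun h => hl.1 (h ▸ hk)
        rw [gram_eq_zero (hcomm k (by simp [hk]) j (by simp) hkj), mul_zero, mul_zero]
      · rw [geomRep_wordProd_apply_of_notMem cs hk]
    · rw [simpleRefl_apply_of_ne hji]
      exact ih' (by simpa [hji] using hj)

/-- Weighted coordinate sum over a set of indices. -/
def weightedSum (x : B → ℝ) (S : Finset B) (v : B → ℝ) : ℝ := ∑ i ∈ S, x i * v i

omit [DecidableEq B] [Fintype B] in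
lemma sum_mul_gram_eq {x : B → ℝ} {S : Finset B}
    (hS : ∀ i ∈ S, ∀ j ∈ S, i ≠ j → M i j = 2) {k : B} (hk : k ∈ S) :
    ∑ j ∈ S, x j * gram M k j = x k := by
  rw [Finset.sum_eq_single_of_mem k hk, gram_self, mul_one]
  intro j hj hjk
  rw [gram_eq_zero (hS k hk j hj hjk.symm), mul_zero]

lemma weightedSum_wordProd {x : B → ℝ} {μ : ℝ} (hx : ∀ i, pair M i x = μ * x i) {S : Finset B}
    (hS : ∀ i ∈ S, ∀ j ∈ S, i ≠ j → M i j = 2) (hS' : ∀ i ∈ Sᶜ, ∀ j ∈ Sᶜ, i ≠ j → M i j = 2)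
    (v : B → ℝ) :
    weightedSum x S (geomRep cs (cs.wordProd S.toList) v) =
      -weightedSum x S v + 2 * (1 - μ) * weightedSum x Sᶜ v := by
  have h1 : weightedSum x S (geomRep cs (cs.wordProd S.toList) v) =
      weightedSum x S v - 2 * ∑ j ∈ S, x j * pair M j v := by
    unfold weightedSum
    rw [Finset.mul_sum, ← Finset.sum_sub_distrib]
    refine Finset.sum_congr rfl fun j hj => ?_
    rw [geomRep_wordProd_apply_of_commute cs S.nodup_toList (by simpa using hS) v (by simpa using hj)]
    ring
  have h2 : ∑ j ∈ S, x j * pair M j v = ∑ k, v k * ∑ j ∈ S, x j * gram M k j := by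
    simp only [pair_apply, Finset.mul_sum]
    rw [Finset.sum_comm]
    exact Finset.sum_congr rfl fun k _ => Finset.sum_congr rfl fun j _ => by ring
  have h3 : ∑ k ∈ S, v k * ∑ j ∈ S, x j * gram M k j = weightedSum x S v :=
    Finset.sum_congr rfl fun k hk => by rw [sum_mul_gram_eq hS hk]; ring
  have h4 : ∑ k ∈ Sᶜ, v k * ∑ j ∈ S, x j * gram M k j = (μ - 1) * weightedSum x Sᶜ v := by
    unfold weightedSum
    rw [Finset.mul_sum]
    refine Finset.sum_congr rfl fun k hk => ?_
    have h5 := hx k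
    have h6 : pair M k x = ∑ j, x j * gram M k j := by
      rw [pair_apply]
      exact Finset.sum_congr rfl fun j _ => by rw [gram_symm]
    rw [h6, ← Finset.sum_add_sum_compl S, sum_mul_gram_eq hS' hk] at h5
    rw [eq_sub_of_add_eq h5]
    ring
  rw [h1, h2, ← Finset.sum_add_sum_compl S, h3, h4]
  ring

lemma weightedSum_wordProd_of_disjoint (x : B → ℝ) {S S' : Finset B} (h : Disjoint S S')
    (v : B → ℝ) :
    weightedSum x S' (geomRep cs (cs.wordProd S.toList) v) = weightedSum x S' v := by
  refine Finset.sum_congr rfl fun j hj => ?_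
  rw [geomRep_wordProd_apply_of_notMem cs]
  simpa using Finset.disjoint_right.mp h hj

omit [Fintype B] [DecidableEq B] in
lemma weightedSum_nonneg {x : B → ℝ} (hx : ∀ i, 0 < x i) (S : Finset B) {v : B → ℝ} (hv : 0 ≤ v) :
    0 ≤ weightedSum x S v :=
  Finset.sum_nonneg fun i _ => mul_nonneg (hx i).le (hv i)

omit [Fintype B] [DecidableEq B] in
lemma weightedSum_nonpos {x : B → ℝ} (hx : ∀ i, 0 < x i) (S : Finset B) {v : B → ℝ} (hv : v ≤ 0) :
    weightedSum x S v ≤ 0 :=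
  Finset.sum_nonpos fun i _ => mul_nonpos_of_nonneg_of_nonpos (hx i).le (hv i)

variable {cs}

lemma IsRoot.weightedSum_mul_nonneg {x : B → ℝ} (hx : ∀ i, 0 < x i) (hM : ∀ i j, M i j ≠ 0)
    {β : B → ℝ} (hβ : IsRoot cs β) (S S' : Finset B) :
    0 ≤ weightedSum x S β * weightedSum x S' β := by
  rcases hβ.nonneg_or_nonpos hM with h | h
  · exact mul_nonneg (weightedSum_nonneg hx S h) (weightedSum_nonneg hx S' h)
  · exact mul_nonneg_of_nonpos_of_nonpos (weightedSum_nonpos hx S h) (weightedSum_nonpos hx S' h)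

lemma IsRoot.weightedSum_add_pos {x : B → ℝ} (hx : ∀ i, 0 < x i) {β : B → ℝ} (hβ : IsRoot cs β)
    (h0 : 0 ≤ β) (S : Finset B) : 0 < weightedSum x S β + weightedSum x Sᶜ β := by
  unfold weightedSum
  rw [Finset.sum_add_sum_compl]
  obtain ⟨i, hi⟩ := Function.ne_iff.mp hβ.ne_zero
  exact Finset.sum_pos' (fun i _ => mul_nonneg (hx i).le (h0 i))
    ⟨i, Finset.mem_univ i, mul_pos (hx i) (lt_of_le_of_ne (h0 i) (Ne.symm hi))⟩

lemma IsRoot.weightedSum_add_neg {x : B → ℝ} (hx : ∀ i, 0 < x i) {β : B → ℝ} (hβ : IsRoot cs β)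
    (h0 : β ≤ 0) (S : Finset B) : weightedSum x S β + weightedSum x Sᶜ β < 0 := by
  have h := hβ.neg.weightedSum_add_pos hx (by simpa using h0) S
  simp only [weightedSum, Pi.neg_apply, mul_neg, Finset.sum_neg_distrib] at h ⊢
  linarith

variable (cs)

/-- Some Coxeter element sends each root orbit from positive to negative only once per period. -/
lemma exists_wordProd_forall_notMem_inversionRoots [Nonempty B] [Finite W]
    (hirr : ∀ J : Finset B, (∀ i ∈ J, ∀ j ∉ J, M i j = 2) → J = ∅ ∨ J = Finset.univ) :
    ∃ l : List B, l.Nodup ∧ (∀ i, i ∈ l) ∧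
      ∀ β ∈ inversionRoots cs (cs.wordProd l), ∀ k, 0 < k → k < orderOf (cs.wordProd l) →
        geomRep cs (cs.wordProd l ^ k) β ∉ inversionRoots cs (cs.wordProd l) := by
  have hM := coxeterMatrix_ne_zero cs
  obtain ⟨x, μ, hx, hμ0, hμ1, heig⟩ := exists_pos_eigenvector cs hirr
  obtain ⟨i₀⟩ := ‹Nonempty B›
  obtain ⟨ε, hε0, hε⟩ := exists_coloring cs i₀
  set S : Finset B := Finset.univ.filter fun i => ε i = true with hSdef
  have hi₀ : i₀ ∈ S := by simp [hSdef, hε0]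
  have hS : ∀ i ∈ S, ∀ j ∈ S, i ≠ j → M i j = 2 := by
    intro i hi j hj hij
    simp only [hSdef, Finset.mem_filter, Finset.mem_univ, true_and] at hi hj
    by_contra h2
    exact hε i j hij h2 (hi.trans hj.symm)
  have hS' : ∀ i ∈ Sᶜ, ∀ j ∈ Sᶜ, i ≠ j → M i j = 2 := by
    intro i hi j hj hij
    simp only [hSdef, Finset.mem_compl, Finset.mem_filter, Finset.mem_univ, true_and,
      Bool.not_eq_true] at hi hj
    by_contra h2
    exact hε i j hij h2 (hi.trans hj.symm)
  set θ := Real.arccos (1 - μ) with hθ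
  have hcos : Real.cos θ = 1 - μ := Real.cos_arccos (by linarith) (by linarith)
  have hθ0 : 0 < θ := Real.arccos_pos.mpr (by linarith)
  have hθ1 : θ ≤ Real.pi / 2 := Real.arccos_le_pi_div_two.mpr (by linarith)
  have hpi := Real.pi_pos
  have hsin : 0 < Real.sin θ := Real.sin_pos_of_pos_of_lt_pi hθ0 (by linarith)
  set c₁ := cs.wordProd S.toList with hc₁
  set c₂ := cs.wordProd Sᶜ.toList with hc₂
  set c := cs.wordProd (S.toList ++ Sᶜ.toList) with hc
  have hcc : c = c₁ * c₂ := cs.wordProd_append _ _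
  have hpow : ∀ (k : ℕ) (v : B → ℝ),
      geomRep cs (c ^ (k + 1)) v = geomRep cs c₁ (geomRep cs c₂ (geomRep cs (c ^ k) v)) := by
    intro k v
    rw [pow_succ', hcc, map_mul, map_mul, Module.End.mul_apply, Module.End.mul_apply]
  have ha1 : ∀ v, weightedSum x S (geomRep cs c₁ v) =
      -weightedSum x S v + 2 * Real.cos θ * weightedSum x Sᶜ v := fun v => by
    rw [hcos]; exact weightedSum_wordProd cs heig hS hS' v
  have ha2 : ∀ v, weightedSum x Sᶜ (geomRep cs c₁ v) = weightedSum x Sᶜ v :=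
    weightedSum_wordProd_of_disjoint cs x disjoint_compl_right
  have hb1 : ∀ v, weightedSum x Sᶜ (geomRep cs c₂ v) =
      -weightedSum x Sᶜ v + 2 * Real.cos θ * weightedSum x S v := fun v => by
    have := weightedSum_wordProd cs heig (S := Sᶜ) hS' (by rwa [compl_compl]) v
    rw [compl_compl] at this
    rw [hcos]; exact this
  have hb2 : ∀ v, weightedSum x S (geomRep cs c₂ v) = weightedSum x S v :=
    weightedSum_wordProd_of_disjoint cs x disjoint_compl_left
  have hrecb : ∀ (v : B → ℝ) (k : ℕ), weightedSum x Sᶜ (geomRep cs (c ^ (k + 1)) v) =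
      -weightedSum x Sᶜ (geomRep cs (c ^ k) v) +
        2 * Real.cos θ * weightedSum x S (geomRep cs (c ^ k) v) := by
    intro v k
    rw [hpow, ha2, hb1]
  have hreca : ∀ (v : B → ℝ) (k : ℕ), weightedSum x S (geomRep cs (c ^ (k + 1)) v) =
      -weightedSum x S (geomRep cs (c ^ k) v) +
        2 * Real.cos θ * weightedSum x Sᶜ (geomRep cs (c ^ (k + 1)) v) := by
    intro v k
    rw [hpow, ha1, ha2, hb2]
  have hclosed := fun v : B → ℝ => sin_mul_eq_of_recurrence (θ := θ)
    (a := fun k => weightedSum x S (geomRep cs (c ^ k) v))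
    (b := fun k => weightedSum x Sᶜ (geomRep cs (c ^ k) v)) (hrecb v) (hreca v)
  simp only [pow_zero, map_one, Module.End.one_apply] at hclosed
  obtain ⟨m, hm2, hm⟩ : ∃ m : ℕ, 2 ≤ m ∧ m * θ = Real.pi := by
    apply exists_mul_eq_pi hθ0 hθ1
    have hroot := isRoot_simpleRoot (cs := cs) i₀
    have h1 : weightedSum x S (simpleRoot i₀) = x i₀ := by
      simp [weightedSum, simpleRoot, Pi.single_apply, hi₀]
    have h2 : weightedSum x Sᶜ (simpleRoot i₀) = 0 := by
      simp [weightedSum, simpleRoot, Pi.single_apply, hi₀]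
    have hcl := hclosed (simpleRoot i₀)
    simp only [h1, h2, zero_mul, sub_zero] at hcl
    have hpos := mul_pos (hx i₀) (hx i₀)
    intro n
    obtain ⟨k, rfl | rfl⟩ := n.even_or_odd'
    · have h3 := (hroot.geomRep_apply (c ^ k)).weightedSum_mul_nonneg hx hM Sᶜ S
      have h4 := mul_nonneg h3 (mul_pos hsin hsin).le
      rw [mul_mul_mul_comm, (hcl k).1, (hcl k).2, mul_mul_mul_comm] at h4
      push_cast
      exact nonneg_of_mul_nonneg_right h4 hpos
    · have h3 := ((hroot.geomRep_apply (c ^ k)).geomRep_apply c₂).weightedSum_mul_nonneg hx hM S Sᶜ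
      have h5 := hcl (k + 1)
      rw [hpow, ha2] at h5
      rw [hb2] at h3
      have h4 := mul_nonneg h3 (mul_pos hsin hsin).le
      rw [mul_mul_mul_comm, (hcl k).1, h5.2, mul_mul_mul_comm] at h4
      push_cast at h4 ⊢
      rw [show 2 * (k : ℝ) + 1 + 1 = 2 * (k + 1) by ring]
      exact nonneg_of_mul_nonneg_right h4 hpos
  have hcm : c ^ m = 1 := by
    have hpres : ∀ v, weightedSum x S (geomRep cs (c ^ m) v) = weightedSum x S v ∧
        weightedSum x Sᶜ (geomRep cs (c ^ m) v) = weightedSum x Sᶜ v := by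
      intro v
      obtain ⟨h1, h2⟩ := hclosed v m
      rw [show (2 * (m : ℝ) + 1) * θ = θ + 2 * Real.pi by rw [← hm]; ring,
        show 2 * (m : ℝ) * θ = 2 * Real.pi by rw [← hm]; ring, Real.sin_add_two_pi,
        Real.sin_two_pi] at h1
      rw [show (2 * (m : ℝ) - 1) * θ = -θ + 2 * Real.pi by rw [← hm]; ring,
        show 2 * (m : ℝ) * θ = 2 * Real.pi by rw [← hm]; ring, Real.sin_add_two_pi,
        Real.sin_two_pi, Real.sin_neg] at h2
      exact ⟨mul_right_cancel₀ hsin.ne' (by linarith), mul_right_cancel₀ hsin.ne' (by linarith)⟩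
    by_contra hne
    obtain ⟨i, hi⟩ := cs.exists_rightDescent_of_ne_one hne
    have h1 := geomRep_simpleRoot_nonpos cs hM (c ^ m) i (cs.isRightDescent_iff.mp hi)
    have hroot := isRoot_simpleRoot (cs := cs) i
    have h2 := (hroot.geomRep_apply (c ^ m)).weightedSum_add_neg hx h1 S
    have h3 := hroot.weightedSum_add_pos hx
      (show (0 : B → ℝ) ≤ simpleRoot i from Pi.single_nonneg.mpr zero_le_one) S
    rw [(hpres _).1, (hpres _).2] at h2
    linarith
  have hord : orderOf c ≤ m := orderOf_le_of_pow_eq_one (by omega) hcm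
  refine ⟨S.toList ++ Sᶜ.toList, ?_, ?_, ?_⟩
  · rw [List.nodup_append']
    refine ⟨S.nodup_toList, Sᶜ.nodup_toList, fun a ha hb => ?_⟩
    simp only [Finset.mem_toList, Finset.mem_compl] at ha hb
    exact hb ha
  · intro i
    simp [em]
  · rw [← hc]
    intro β hβ k hk0 hk hβk
    obtain ⟨hr, hp, hn⟩ := hβ
    obtain ⟨hr', hp', hn'⟩ := hβk
    have h := no_second_descent hθ0 hm2 hm
      (F := fun k => weightedSum x S (geomRep cs (c ^ k) β) +
        weightedSum x Sᶜ (geomRep cs (c ^ k) β)) (k := k) (by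
          intro j
          have e1 := hreca β j
          have e2 := hrecb β j
          have e3 := hreca β (j + 1)
          have e4 := hrecb β (j + 1)
          rw [Real.cos_two_mul]
          linear_combination e3 + (1 + 2 * Real.cos θ) * e4 + (1 + 2 * Real.cos θ) * e1 + e2) (by
          simpa using hr.weightedSum_add_pos hx hp S) (by
          simpa using (hr.geomRep_apply c).weightedSum_add_neg hx hn S) hk0 (by omega)
      (hr'.weightedSum_add_pos hx hp' S)
    rw [pow_succ', map_mul, Module.End.mul_apply] at h
    have := (hr'.geomRep_apply c).weightedSum_add_neg hx hn' S
    linarith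

end Bipartite

lemma orderOf_eq_of_isConj {G : Type*} [Group G] {a b : G} (h : IsConj a b) :
    orderOf a = orderOf b := by
  obtain ⟨g, rfl⟩ := isConj_iff.mp h
  exact (orderOf_injective (MulAut.conj g).toMonoidHom (MulAut.conj g).injective a).symm

lemma exists_nat_lt_orderOf_zpow_eq {G : Type*} [Group G] [Finite G] (c : G) (k : ℤ) :
    ∃ r < orderOf c, c ^ k = c ^ r := by
  have h0 : (0 : ℤ) < orderOf c := by exact_mod_cast orderOf_pos c
  have h1 := Int.emod_nonneg k h0.ne'
  have h2 := Int.emod_lt_of_pos k h0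
  refine ⟨(k % orderOf c).toNat, by omega, ?_⟩
  rw [← zpow_natCast, Int.toNat_of_nonneg h1, zpow_mod_orderOf]

/-- The size of an orbit of conjugation by the powers of an element is the minimal period. -/
lemma ncard_conj_orbit {G : Type*} [Group G] {c t : G} {p : ℕ} (hp : 0 < p)
    (h1 : c ^ p * t * (c ^ p)⁻¹ = t)
    (h2 : ∀ j, 0 < j → j < p → c ^ j * t * (c ^ j)⁻¹ ≠ t) :
    {x : G | ∃ k : ℤ, x = c ^ k * t * (c ^ k)⁻¹}.ncard = p := by
  have hcomm : Commute (c ^ p) t := by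
    rw [commute_iff_eq]
    exact mul_inv_eq_iff_eq_mul.mp h1
  have hset : {x : G | ∃ k : ℤ, x = c ^ k * t * (c ^ k)⁻¹} =
      (fun k : ℕ => c ^ k * t * (c ^ k)⁻¹) '' (Finset.range p : Set ℕ) := by
    ext x
    constructor
    · rintro ⟨k, rfl⟩
      have h0 : (0 : ℤ) < p := by exact_mod_cast hp
      have h3 := Int.emod_nonneg k h0.ne'
      have h4 := Int.emod_lt_of_pos k h0
      refine ⟨(k % p).toNat, by simp; omega, ?_⟩
      have h5 : c ^ k = c ^ (k % p).toNat * (c ^ p) ^ (k / p) := by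
        rw [← zpow_natCast, Int.toNat_of_nonneg h3, ← zpow_natCast, ← zpow_mul, ← zpow_add,
          Int.emod_add_mul_ediv]
      have h6 : (c ^ p) ^ (k / p) * t = t * (c ^ p) ^ (k / p) := hcomm.zpow_left _
      simp only
      rw [h5, mul_inv_rev, mul_assoc _ _ t, h6]
      group
    · rintro ⟨k, -, rfl⟩
      exact ⟨k, by simp⟩
  have hlt : ∀ j k : ℕ, j < k → k < p → c ^ j * t * (c ^ j)⁻¹ ≠ c ^ k * t * (c ^ k)⁻¹ := by
    intro j k hjk hk heq
    refine h2 (k - j) (by omega) (by omega) ?_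
    obtain ⟨d, rfl⟩ := Nat.exists_eq_add_of_le hjk.le
    rw [Nat.add_sub_cancel_left]
    have : c ^ j * (c ^ d * t * (c ^ d)⁻¹) * (c ^ j)⁻¹ = c ^ j * t * (c ^ j)⁻¹ := by
      rw [heq, pow_add]; group
    exact mul_left_cancel (mul_right_cancel this)
  rw [hset, Set.InjOn.ncard_image, Set.ncard_coe_finset, Finset.card_range]
  intro j hj k hk heq
  simp only [Finset.coe_range, Set.mem_Iio] at hj hk
  rcases lt_trichotomy j k with h | h | h
  · exact absurd heq (hlt j k h hk)
  · exact h
  · exact absurd heq.symm (hlt k j h hj)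

section CoxeterElement

open CoxeterSystem

variable {B W : Type*} [Group W] [Fintype B] [DecidableEq B] {M : CoxeterMatrix B}
  (cs : CoxeterSystem M W)

open Classical in
lemma sum_card_filter_inversionRoots [Finite W] {l : List B} (hl : l.Nodup) (hmem : ∀ i, i ∈ l) :
    ∑ β ∈ (finite_setOf_isRoot cs).toFinset, ((Finset.range (orderOf (cs.wordProd l))).filter
      fun k => geomRep cs (cs.wordProd l ^ k) β ∈ inversionRoots cs (cs.wordProd l)).card =
      orderOf (cs.wordProd l) * Fintype.card B := by
  set c := cs.wordProd l with hc
  have hlen : l.length = Fintype.card B := by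
    rw [← List.toFinset_card_of_nodup hl, Finset.card_eq_iff_eq_univ]
    ext i
    simp [hmem]
  have h1 := Finset.sum_card_bipartiteAbove_eq_sum_card_bipartiteBelow
    (s := (finite_setOf_isRoot cs).toFinset) (t := Finset.range (orderOf c))
    fun β k => geomRep cs (c ^ k) β ∈ inversionRoots cs c
  unfold Finset.bipartiteAbove Finset.bipartiteBelow at h1
  rw [h1, ← hlen, ← ncard_inversionRoots_wordProd cs hl]
  refine (Finset.sum_const_nat fun k _ => ?_).trans (by rw [Finset.card_range])
  rw [← Set.ncard_coe_finset]
  refine Set.ncard_congr (fun β _ => geomRep cs (c ^ k) β) ?_ ?_ ?_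
  · intro β hβ
    simpa using (Finset.mem_filter.mp (Finset.mem_coe.mp hβ)).2
  · intro β γ _ _ h
    exact geomRep_injective_apply cs _ h
  · intro β hβ
    refine ⟨geomRep cs (c ^ k)⁻¹ β, ?_, geomRep_self_apply_inv cs _ _⟩
    simp only [Finset.coe_filter, Set.Finite.mem_toFinset, Set.mem_ofPred_eq]
    refine ⟨hβ.1.geomRep_apply _, ?_⟩
    rw [geomRep_self_apply_inv]
    exact hβ

/-- Each root orbit of a Coxeter element passes from positive to negative once per period. -/
lemma eq_of_mem_inversionRoots [Nonempty B] [Finite W]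
    (hirr : ∀ J : Finset B, (∀ i ∈ J, ∀ j ∉ J, M i j = 2) → J = ∅ ∨ J = Finset.univ)
    {l : List B} (hl : l.Nodup) (hmem : ∀ i, i ∈ l) {β : B → ℝ} (hβ : IsRoot cs β) {j k : ℕ}
    (hj : j < orderOf (cs.wordProd l)) (hk : k < orderOf (cs.wordProd l))
    (hj' : geomRep cs (cs.wordProd l ^ j) β ∈ inversionRoots cs (cs.wordProd l))
    (hk' : geomRep cs (cs.wordProd l ^ k) β ∈ inversionRoots cs (cs.wordProd l)) : j = k := by
  classical
  obtain ⟨l₀, hl₀, hmem₀, h₀⟩ := exists_wordProd_forall_notMem_inversionRoots cs hirr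
  have hperm : l₀.Perm l := (List.perm_ext_iff_of_nodup hl₀ hl).mpr fun a => by simp [hmem, hmem₀]
  have hord : orderOf (cs.wordProd l₀) = orderOf (cs.wordProd l) :=
    orderOf_eq_of_isConj ((wordConj_of_perm cs hl₀ hperm).isConj cs)
  have hs₀ := sum_card_filter_inversionRoots cs hl₀ hmem₀
  have hs := sum_card_filter_inversionRoots cs hl hmem
  have hone : ∀ γ ∈ (finite_setOf_isRoot cs).toFinset,
      ((Finset.range (orderOf (cs.wordProd l₀))).filter fun k =>
        geomRep cs (cs.wordProd l₀ ^ k) γ ∈ inversionRoots cs (cs.wordProd l₀)).card ≤ 1 := by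
    intro γ _
    have hlt : ∀ a b, a < b → b < orderOf (cs.wordProd l₀) →
        geomRep cs (cs.wordProd l₀ ^ a) γ ∈ inversionRoots cs (cs.wordProd l₀) →
        geomRep cs (cs.wordProd l₀ ^ b) γ ∉ inversionRoots cs (cs.wordProd l₀) := by
      intro a b hab hb ha'
      have := h₀ _ ha' (b - a) (by omega) (by omega)
      rwa [← Module.End.mul_apply, ← map_mul, ← pow_add, Nat.sub_add_cancel hab.le] at this
    rw [Finset.card_le_one]
    intro a ha b hb
    rw [Finset.mem_filter, Finset.mem_range] at ha hb
    rcases lt_trichotomy a b with h | h | h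
    · exact absurd hb.2 (hlt a b h hb.1 ha.2)
    · exact h
    · exact absurd ha.2 (hlt b a h ha.1 hb.2)
  have hge : ∀ γ ∈ (finite_setOf_isRoot cs).toFinset,
      1 ≤ ((Finset.range (orderOf (cs.wordProd l))).filter fun k =>
        geomRep cs (cs.wordProd l ^ k) γ ∈ inversionRoots cs (cs.wordProd l)).card := by
    intro γ hγ
    obtain ⟨k, hk, hk'⟩ := exists_pow_mem_inversionRoots cs hl hmem
      (by simpa using hγ : IsRoot cs γ)
    exact Finset.card_pos.mpr ⟨k, Finset.mem_filter.mpr ⟨Finset.mem_range.mpr hk, hk'⟩⟩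
  have hle := Finset.sum_le_sum hone
  have hle' := Finset.sum_le_sum hge
  have heq := (Finset.sum_eq_sum_iff_of_le hge).mp (le_antisymm hle' (by
    rw [hs, ← hord, ← hs₀]; exact hle)) β (by simpa using hβ)
  exact Finset.card_le_one.mp heq.ge j
    (Finset.mem_filter.mpr ⟨Finset.mem_range.mpr hj, hj'⟩) k
    (Finset.mem_filter.mpr ⟨Finset.mem_range.mpr hk, hk'⟩)

/-- The powers of a Coxeter element act freely on the roots. -/
lemma orderOf_dvd_of_geomRep_pow_eq [Nonempty B] [Finite W]
    (hirr : ∀ J : Finset B, (∀ i ∈ J, ∀ j ∉ J, M i j = 2) → J = ∅ ∨ J = Finset.univ)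
    {l : List B} (hl : l.Nodup) (hmem : ∀ i, i ∈ l) {β : B → ℝ} (hβ : IsRoot cs β) {k : ℕ}
    (hk : geomRep cs (cs.wordProd l ^ k) β = β) : orderOf (cs.wordProd l) ∣ k := by
  obtain ⟨j, -, hj⟩ := exists_pow_mem_inversionRoots cs hl hmem hβ
  have hpos := orderOf_pos (cs.wordProd l)
  have h := eq_of_mem_inversionRoots cs hirr hl hmem (hβ.geomRep_apply (cs.wordProd l ^ j))
    (j := k % orderOf (cs.wordProd l)) (k := 0) (Nat.mod_lt _ hpos) hpos (by
      rw [pow_mod_orderOf, ← Module.End.mul_apply, ← map_mul, ← pow_add, add_comm, pow_add,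
        map_mul, Module.End.mul_apply, hk]
      exact hj) (by simpa using hj)
  exact Nat.dvd_of_mod_eq_zero h

variable {cs} in
lemma IsReflectionIn.isRightInversion_iff_mem {t : W} {β : B → ℝ} (hM : ∀ i j, M i j ≠ 0)
    (h : IsReflectionIn cs t β) (w : W) :
    cs.IsRightInversion w t ↔ β ∈ inversionRoots cs w ∨ -β ∈ inversionRoots cs w := by
  rcases h.isRoot.nonneg_or_nonpos hM with h0 | h0
  · rw [h.isRightInversion_iff hM h0]
    refine ⟨fun h1 => .inl ⟨h.isRoot, h0, h1⟩, ?_⟩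
    rintro (h1 | h1)
    · exact h1.2.2
    · exact (h.isRoot.not_nonneg_and_nonpos h0 (neg_nonneg.mp h1.2.1)).elim
  · rw [h.neg.isRightInversion_iff hM (neg_nonneg.mpr h0)]
    refine ⟨fun h1 => .inr ⟨h.neg.isRoot, neg_nonneg.mpr h0, h1⟩, ?_⟩
    rintro (h1 | h1)
    · exact (h.isRoot.not_nonneg_and_nonpos h1.2.1 h0).elim
    · exact h1.2.2

/-- The right inversions of a Coxeter element in a conjugation orbit come from the two roots of a
reflection in the orbit. -/
lemma conj_orbit_inter_isRightInversion [Nonempty B] [Finite W]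
    (hirr : ∀ J : Finset B, (∀ i ∈ J, ∀ j ∉ J, M i j = 2) → J = ∅ ∨ J = Finset.univ)
    {l : List B} (hl : l.Nodup) (hmem : ∀ i, i ∈ l) {c : W} (hc : c = cs.wordProd l)
    {t : W} {β : B → ℝ} (ht : IsReflectionIn cs t β) {a b : ℕ}
    (ha : a < orderOf c) (ha' : geomRep cs (c ^ a) β ∈ inversionRoots cs c)
    (hb : b < orderOf c) (hb' : geomRep cs (c ^ b) (-β) ∈ inversionRoots cs c) :
    {x : W | ∃ k : ℤ, x = c ^ k * t * (c ^ k)⁻¹} ∩ {t' : W | cs.IsRightInversion c t'} =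
      {c ^ a * t * (c ^ a)⁻¹, c ^ b * t * (c ^ b)⁻¹} := by
  have hM := coxeterMatrix_ne_zero cs
  subst hc
  ext x
  simp only [Set.mem_inter_iff, Set.mem_ofPred_eq, Set.mem_insert_iff, Set.mem_singleton_iff]
  constructor
  · rintro ⟨⟨k, rfl⟩, hx⟩
    obtain ⟨r, hr, hkr⟩ := exists_nat_lt_orderOf_zpow_eq (cs.wordProd l) k
    rw [hkr] at hx ⊢
    rw [(ht.conj (cs.wordProd l ^ r)).isRightInversion_iff_mem hM, ← map_neg] at hx
    rcases hx with hx | hx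
    · rw [eq_of_mem_inversionRoots cs hirr hl hmem ht.isRoot hr ha hx ha']
      exact .inl rfl
    · rw [eq_of_mem_inversionRoots cs hirr hl hmem ht.isRoot.neg hr hb hx hb']
      exact .inr rfl
  · rintro (rfl | rfl)
    · refine ⟨⟨a, by simp⟩, ?_⟩
      rw [(ht.conj _).isRightInversion_iff_mem hM]
      exact .inl ha'
    · refine ⟨⟨b, by simp⟩, ?_⟩
      rw [(ht.conj _).isRightInversion_iff_mem hM, ← map_neg]
      exact .inr hb'

end CoxeterElement

/-- Let `W` be an irreducible finite Coxeter group (equivalently, an irreducible finite real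
reflection group) with Coxeter element `c` (a product of all the simple reflections, in some
order) and Coxeter number `h = orderOf c`.  Then each orbit of the conjugation action
`t ↦ c t c⁻¹` of `c` on the set `T` of reflections either has cardinality `h/2` and contains
exactly one right inversion of `c`, or has cardinality `h` and contains exactly two right
inversions of `c`. -/
theorem stmt_3 {W : Type*} [Group W] [Finite W] {n : ℕ} {M : CoxeterMatrix (Fin n)}
    (cs : CoxeterSystem M W)
    (hirr : ∀ J : Finset (Fin n), (∀ i ∈ J, ∀ j ∉ J, M i j = 2) → J = ∅ ∨ J = Finset.univ)
    (c : W) (hc : ∃ l : List (Fin n), l.Perm (List.finRange n) ∧ c = cs.wordProd l)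
    (h : ℕ) (hh : h = orderOf c) :
    ∀ t : W, cs.IsReflection t →
      (2 * Set.ncard {x : W | ∃ k : ℤ, x = c ^ k * t * (c ^ k)⁻¹} = h ∧
        Set.ncard ({x : W | ∃ k : ℤ, x = c ^ k * t * (c ^ k)⁻¹} ∩
          {t' : W | cs.IsRightInversion c t'}) = 1) ∨
      (Set.ncard {x : W | ∃ k : ℤ, x = c ^ k * t * (c ^ k)⁻¹} = h ∧
        Set.ncard ({x : W | ∃ k : ℤ, x = c ^ k * t * (c ^ k)⁻¹} ∩
          {t' : W | cs.IsRightInversion c t'}) = 2) := by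
  intro t hrefl
  have : Nonempty (Fin n) := ⟨hrefl.choose_spec.choose⟩
  have hM := coxeterMatrix_ne_zero cs
  obtain ⟨l, hperm, hcl⟩ := hc
  have hl : l.Nodup := hperm.nodup_iff.mpr (List.nodup_finRange n)
  have hmem : ∀ i, i ∈ l := fun i => hperm.mem_iff.mpr (List.mem_finRange i)
  obtain ⟨β, ht⟩ := exists_isReflectionIn hrefl
  have hβ := ht.isRoot
  have hpos : 0 < orderOf c := orderOf_pos c
  have hfree : ∀ k, geomRep cs (c ^ k) β = β → orderOf c ∣ k := fun k hk => by
    subst hcl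
    exact orderOf_dvd_of_geomRep_pow_eq cs hirr hl hmem hβ hk
  obtain ⟨a, ha, ha'⟩ := exists_pow_mem_inversionRoots cs hl hmem hβ
  obtain ⟨b, hb, hb'⟩ := exists_pow_mem_inversionRoots cs hl hmem hβ.neg
  rw [← hcl] at ha ha' hb hb'
  rw [conj_orbit_inter_isRightInversion cs hirr hl hmem hcl ht ha ha' hb hb', hh]
  have hfix : ∀ k, c ^ k * t * (c ^ k)⁻¹ = t →
      geomRep cs (c ^ k) β = β ∨ geomRep cs (c ^ k) β = -β := by
    intro k hk
    have h1 := ht.conj (c ^ k)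
    rw [hk] at h1
    exact ht.eq_or_eq_neg h1
  by_cases hneg : ∃ k, geomRep cs (c ^ k) β = -β
  · left
    obtain ⟨k, hk⟩ := hneg
    set p := k % orderOf c with hp
    have hplt : p < orderOf c := Nat.mod_lt _ hpos
    have hpβ : geomRep cs (c ^ p) β = -β := by rw [hp, pow_mod_orderOf, hk]
    have hp0 : 0 < p := by
      rw [Nat.pos_iff_ne_zero]
      intro h0
      rw [h0, pow_zero, map_one, Module.End.one_apply] at hpβ
      exact hβ.ne_zero (self_eq_neg.mp hpβ)
    have hdouble : ∀ j, geomRep cs (c ^ j) β = -β → orderOf c ∣ 2 * j := by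
      intro j hj
      apply hfree
      rw [two_mul, pow_add, map_mul, Module.End.mul_apply, hj, map_neg, hj, neg_neg]
    have h2p : 2 * p = orderOf c := by
      obtain ⟨q, hq⟩ := hdouble p hpβ
      have : q < 2 := by
        by_contra hq2
        nlinarith
      interval_cases q <;> omega
    refine ⟨?_, ?_⟩
    · rw [ncard_conj_orbit hp0, h2p]
      · have h1 := (ht.conj (c ^ p)).neg
        rw [hpβ, neg_neg] at h1
        exact h1.eq hM ht
      · intro j hj0 hj hfixj
        rcases hfix j hfixj with h1 | h1
        · exact absurd (Nat.le_of_dvd hj0 (hfree j h1)) (by omega)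
        · exact absurd (Nat.le_of_dvd (by omega) (hdouble j h1)) (by omega)
    · have hbp : geomRep cs (c ^ b) (-β) = geomRep cs (c ^ ((b + p) % orderOf c)) β := by
        rw [pow_mod_orderOf, pow_add, map_mul, Module.End.mul_apply, hpβ]
      have hab : (b + p) % orderOf c = a := by
        rw [hbp] at hb'
        subst hcl
        exact eq_of_mem_inversionRoots cs hirr hl hmem hβ (Nat.mod_lt _ hpos) ha hb' ha'
      rw [hab] at hbp
      have h1 := ht.neg.conj (c ^ b)
      rw [hbp] at h1
      rw [(ht.conj (c ^ a)).eq hM h1, Set.pair_eq_singleton, Set.ncard_singleton]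
  · right
    refine ⟨?_, ?_⟩
    · apply ncard_conj_orbit hpos
      · simp [pow_orderOf_eq_one]
      · intro j hj0 hj hfixj
        rcases hfix j hfixj with h1 | h1
        · exact absurd (Nat.le_of_dvd hj0 (hfree j h1)) (by omega)
        · exact hneg ⟨j, h1⟩
    · apply Set.ncard_pair
      intro heq
      have h1 := ht.conj (c ^ a)
      have h2 := ht.neg.conj (c ^ b)
      rw [← heq] at h2
      rcases h1.eq_or_eq_neg h2 with h3 | h3
      · refine hneg ⟨orderOf c - b + a, ?_⟩
        rw [pow_add, map_mul, Module.End.mul_apply, ← h3, ← Module.End.mul_apply, ← map_mul,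
          ← pow_add, Nat.sub_add_cancel hb.le, pow_orderOf_eq_one, map_one, Module.End.one_apply]
      · refine ha'.1.not_nonneg_and_nonpos ha'.2.1 ?_
        rw [← neg_nonneg, ← h3]
        exact hb'.2.1

end Stmt3
end

section
/- In the noncrossing partition lattice NC(W,c) of a finite real reflection group W, for any u, w ∈ NC(W,c) with u ≤ w in absolute order, there exists a unique v ∈ NC(W,c) such that u ≪ v ⊏ w, where ⊏ and ≪ are the two refined orders on NC(W,c). -/
namespace Stmt9

variable {B W : Type*} [Group W] {M : CoxeterMatrix B} (cs : CoxeterSystem M W)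

/-- Reflection length `ℓ_T`. -/
noncomputable def reflLen (w : W) : ℕ :=
  sInf {k | ∃ l : List W, l.length = k ∧ (∀ t ∈ l, cs.IsReflection t) ∧ l.prod = w}

/-- Absolute order. -/
def absLe (u v : W) : Prop := reflLen cs u + reflLen cs (u⁻¹ * v) = reflLen cs v

variable (cf : W → List W)

/-- `v ⊏ w`: `v` is the product of a subword of the canonical factorization of `w`. -/
def sqsub (v w : W) : Prop := ∃ l : List W, l.Sublist (cf w) ∧ l.prod = v

/-- `v ≪ w`: `v ≤ w` and `v` has full support in `W_{Fix(w)}`, i.e. every factor of the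
canonical factorization of `w` appears in any expression of `v` as a product of these
factors. -/
def ll (v w : W) : Prop :=
  absLe cs v w ∧
    ∀ l : List W, (∀ t ∈ l, t ∈ cf w) → l.prod = v → ∀ t ∈ cf w, t ∈ l

section Helpers

open Module Polynomial.Chebyshev

section Representation

/-- The coefficients of the Cartan matrix attached to a Coxeter matrix. -/
noncomputable def cartan (M : CoxeterMatrix B) (i j : B) : ℝ := -(2 * Real.cos (Real.pi / M i j))

/-- The simple root indexed by `i`. -/
noncomputable def root (i : B) : B →₀ ℝ := Finsupp.single i 1

/-- The simple coroot indexed by `i`. -/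
noncomputable def coroot (M : CoxeterMatrix B) (i : B) : Dual ℝ (B →₀ ℝ) :=
  Finsupp.linearCombination ℝ (cartan M i)

lemma coroot_root (M : CoxeterMatrix B) (i j : B) : coroot M i (root j) = cartan M i j := by
  simp [coroot, root]

lemma cartan_self (M : CoxeterMatrix B) (i : B) : cartan M i i = 2 := by
  simp [cartan]

lemma coroot_root_self (M : CoxeterMatrix B) (i : B) : coroot M i (root i) = 2 := by
  rw [coroot_root, cartan_self]

lemma cartan_comm (M : CoxeterMatrix B) (i j : B) : cartan M i j = cartan M j i := by
  simp [cartan, M.symmetric i j]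

/-- The simple reflection of the geometric representation. -/
noncomputable def simpleRefl (M : CoxeterMatrix B) (i : B) : (B →₀ ℝ) ≃ₗ[ℝ] (B →₀ ℝ) :=
  reflection (coroot_root_self M i)

lemma simpleRefl_apply (M : CoxeterMatrix B) (i : B) (x : B →₀ ℝ) :
    simpleRefl M i x = x - coroot M i x • root i := reflection_apply _ _

lemma sin_pi_div_pos {m : ℕ} (hm : 2 ≤ m) : 0 < Real.sin (Real.pi / m) := by
  have : (2 : ℝ) ≤ m := by exact_mod_cast hm
  apply Real.sin_pos_of_pos_of_lt_pi (by positivity)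
  exact div_lt_self Real.pi_pos (by linarith)

lemma isLiftable_simpleRefl (M : CoxeterMatrix B) : M.IsLiftable (simpleRefl M) := by
  intro i j
  rcases eq_or_ne i j with rfl | hij
  · rw [M.diagonal, pow_one]
    exact LinearEquiv.ext (involutive_reflection (coroot_root_self M i))
  have h1 := M.off_diagonal i j hij
  apply LinearEquiv.toLinearMap_injective
  set θ : ℝ := Real.pi / M i j with hθ
  have hc : cartan M i j = -(2 * Real.cos θ) := rfl
  have ht : 2 * Real.cos (2 * θ) = coroot M i (root j) * coroot M j (root i) - 2 := by
    rw [coroot_root, coroot_root, cartan_comm M j i, hc, Real.cos_two_mul]; ring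
  have key := reflection_mul_reflection_pow (coroot_root_self M i) (coroot_root_self M j) (M i j)
    (2 * Real.cos (2 * θ)) ht
  rw [simpleRefl, simpleRefl, key]
  obtain h0 | h2 | h3 : M i j = 0 ∨ M i j = 2 ∨ 3 ≤ M i j := by omega
  · simp [h0]
  · have hθ2 : θ = Real.pi / 2 := by simp [hθ, h2]
    have h4 : 2 * Real.cos (2 * θ) = -2 := by rw [hθ2, mul_div_cancel₀ _ two_ne_zero]; simp
    rw [h4, h2, coroot_root, coroot_root, cartan_comm M j i, hc, hθ2]
    norm_num
    ext; simp; ring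
  · have hs := sin_pi_div_pos (m := M i j) (by omega)
    rw [← hθ] at hs
    have hm : (M i j : ℝ) * θ = Real.pi := by
      rw [hθ]; field_simp
    have hcos : 0 < Real.cos θ := by
      have : (3 : ℝ) ≤ M i j := by exact_mod_cast h3
      have hp := Real.pi_pos
      apply Real.cos_pos_of_mem_Ioo ⟨?_, ?_⟩
      · have : 0 < θ := by positivity
        linarith
      · rw [hθ]; gcongr; linarith
    have hs2 : Real.sin (2 * θ) ≠ 0 := by rw [Real.sin_two_mul]; positivity
    rcases Nat.even_or_odd' (M i j) with ⟨k, hk | hk⟩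
    · have e1 : ((M i j : ℤ) - 2) / 2 = (k : ℤ) - 1 := by omega
      have z : (S ℝ ((k : ℤ) - 1)).eval (2 * Real.cos (2 * θ)) = 0 := by
        have := S_two_mul_real_cos (2 * θ) ((k : ℤ) - 1)
        apply (mul_eq_zero.mp (this.trans _)).resolve_right hs2
        have e : ((((k : ℤ) - 1 : ℤ) : ℝ) + 1) * (2 * θ) = Real.pi := by
          rw [← hm, hk]; push_cast; ring
        rw [e, Real.sin_pi]
      have e2 : ((M i j : ℤ) - 1) / 2 = (k : ℤ) - 1 := by omega
      rw [e1, e2, z]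
      simp
    · have e1 : ((M i j : ℤ) - 1) / 2 = (k : ℤ) := by omega
      have e2 : ((M i j : ℤ) - 3) / 2 = (k : ℤ) - 1 := by omega
      have e3 : ((M i j : ℤ) - 2) / 2 = (k : ℤ) - 1 := by omega
      have e4 : (M i j : ℤ) / 2 = (k : ℤ) := by omega
      have z : (S ℝ (k : ℤ)).eval (2 * Real.cos (2 * θ)) +
          (S ℝ ((k : ℤ) - 1)).eval (2 * Real.cos (2 * θ)) = 0 := by
        have a := S_two_mul_real_cos (2 * θ) (k : ℤ)
        have b := S_two_mul_real_cos (2 * θ) ((k : ℤ) - 1)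
        apply (mul_eq_zero.mp (_ : _ * Real.sin (2 * θ) = 0)).resolve_right hs2
        rw [add_mul, a, b]
        have e5 : (((k : ℤ) : ℝ) + 1) * (2 * θ) = Real.pi + θ := by
          rw [← hm, hk]; push_cast; ring
        have e6 : ((((k : ℤ) - 1 : ℤ) : ℝ) + 1) * (2 * θ) = Real.pi - θ := by
          rw [← hm, hk]; push_cast; ring
        rw [e5, e6, add_comm Real.pi, Real.sin_add_pi, Real.sin_pi_sub]; ring
      rw [e1, e2, e3, e4, z]
      simp

/-- The geometric representation of a Coxeter group. -/
noncomputable def rep : W →* ((B →₀ ℝ) ≃ₗ[ℝ] (B →₀ ℝ)) :=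
  cs.lift ⟨simpleRefl M, isLiftable_simpleRefl M⟩

lemma rep_simple (i : B) : rep cs (cs.simple i) = simpleRefl M i :=
  cs.lift_apply_simple (isLiftable_simpleRefl M) i

lemma rep_simple_root (i : B) : rep cs (cs.simple i) (root i) = -root i := by
  rw [rep_simple, simpleRefl_apply, coroot_root_self]; module

lemma rep_mul_apply (g h : W) (x : B →₀ ℝ) : rep cs (g * h) x = rep cs g (rep cs h x) := by
  rw [map_mul, LinearEquiv.mul_apply]

lemma rep_one_apply (x : B →₀ ℝ) : rep cs 1 x = x := by
  rw [map_one, LinearEquiv.coe_one, id]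

lemma rep_inv_apply_eq (g : W) {x y : B →₀ ℝ} (h : rep cs g x = y) : rep cs g⁻¹ y = x := by
  rw [← h, ← rep_mul_apply, inv_mul_cancel, rep_one_apply]

end Representation

section Positivity

lemma S_eval_nonneg (m : ℕ) (hm : m ≠ 1) (n : ℤ) (hn : -1 ≤ n) (h : m ≠ 0 → n + 1 ≤ m) :
    0 ≤ (S ℝ n).eval (2 * Real.cos (Real.pi / m)) := by
  rcases Nat.eq_zero_or_pos m with rfl | hpos
  · simp only [Nat.cast_zero, div_zero, Real.cos_zero, mul_one, S_eval_two]
    exact_mod_cast (by omega : 0 ≤ n + 1)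
  · have hs := sin_pi_div_pos (m := m) (by omega)
    have h1 := S_two_mul_real_cos (Real.pi / m) n
    have hm0 : (0 : ℝ) < m := by exact_mod_cast hpos
    have hn' : (0 : ℝ) ≤ (n : ℝ) + 1 := by exact_mod_cast (by omega : 0 ≤ n + 1)
    have hn2 : (n : ℝ) + 1 ≤ m := by exact_mod_cast h (by omega)
    have h2 : 0 ≤ Real.sin (((n : ℝ) + 1) * (Real.pi / m)) := by
      apply Real.sin_nonneg_of_nonneg_of_le_pi
      · have := Real.pi_pos
        positivity
      · calc ((n : ℝ) + 1) * (Real.pi / m) ≤ m * (Real.pi / m) := by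
              gcongr
          _ = Real.pi := by field_simp
    rw [← h1] at h2
    exact nonneg_of_mul_nonneg_left h2 hs

lemma rep_alternatingWord_root (i j : B) (k : ℕ) :
    rep cs (cs.wordProd (CoxeterSystem.alternatingWord i j k)) (root i) =
      if Even k then
        (S ℝ k).eval (2 * Real.cos (Real.pi / M i j)) • root i +
          (S ℝ (k - 1)).eval (2 * Real.cos (Real.pi / M i j)) • root j
      else
        (S ℝ (k - 1)).eval (2 * Real.cos (Real.pi / M i j)) • root i +
          (S ℝ k).eval (2 * Real.cos (Real.pi / M i j)) • root j := by
  induction k with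
  | zero => simp [CoxeterSystem.alternatingWord]
  | succ k ih =>
    have hS := S_add_one ℝ k
    have hS' : (S ℝ ((k : ℤ) + 1)).eval (2 * Real.cos (Real.pi / M i j)) =
      (2 * Real.cos (Real.pi / M i j)) * (S ℝ k).eval (2 * Real.cos (Real.pi / M i j)) -
        (S ℝ (k - 1)).eval (2 * Real.cos (Real.pi / M i j)) := by rw [hS]; simp
    rw [CoxeterSystem.alternatingWord_succ', CoxeterSystem.wordProd_cons, rep_mul_apply, ih,
      rep_simple, simpleRefl_apply]
    push_cast
    rw [add_sub_cancel_right, hS']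
    by_cases hk : Even k
    · simp only [hk, if_true, Nat.even_add_one, not_true_eq_false, if_false, map_add, map_smul,
        coroot_root, smul_eq_mul, cartan_comm M j i, cartan_self]
      simp only [cartan]
      module
    · simp only [hk, if_false, Nat.even_add_one, not_false_eq_true, if_true, map_add, map_smul,
        coroot_root, cartan_self, smul_eq_mul]
      simp only [cartan]
      module

theorem rep_root_nonneg (w : W) (i : B) (h : ¬ cs.IsRightDescent w i) :
    0 ≤ rep cs w (root i) := by
  induction hn : cs.length w using Nat.strong_induction_on generalizing w i with
  | _ n ih =>
  subst hn
  by_cases hw : w = 1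
  · subst hw
    rw [rep_one_apply]
    exact Finsupp.single_nonneg.mpr zero_le_one
  obtain ⟨j, hj⟩ := cs.exists_rightDescent_of_ne_one hw
  have hij : i ≠ j := by rintro rfl; exact h hj
  let P : ℕ → Prop := fun k => ∃ v, w = v * cs.wordProd (CoxeterSystem.alternatingWord i j k) ∧
    cs.length w = cs.length v + k
  have hP1 : P 1 := by
    refine ⟨w * cs.simple j, ?_, ?_⟩
    · simp [CoxeterSystem.alternatingWord]
    · exact ((cs.isRightDescent_iff).mp hj).symm
  classical
  have hbd : ∀ k, P k → k ≤ cs.length w := by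
    rintro k ⟨v, -, hv⟩; omega
  obtain ⟨v, hv, hl⟩ := Nat.findGreatest_spec (P := P) (hbd 1 hP1) hP1
  have hmax := Nat.le_findGreatest (P := P) (hbd 1 hP1) hP1
  have hgt : ¬ P (Nat.findGreatest P (cs.length w) + 1) := fun hp =>
    absurd (Nat.le_findGreatest (P := P) (hbd _ hp) hp) (by omega)
  set k := Nat.findGreatest P (cs.length w)
  obtain ⟨k', hk'⟩ : ∃ k', k = k' + 1 := ⟨k - 1, by omega⟩
  have hlen (a b : B) (k : ℕ) :
      cs.length (cs.wordProd (CoxeterSystem.alternatingWord a b k)) ≤ k := by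
    simpa using cs.length_wordProd_le (CoxeterSystem.alternatingWord a b k)
  have hnext : ¬ cs.IsRightDescent v (if Even k then j else i) := by
    intro hd
    apply hgt
    refine ⟨v * cs.simple (if Even k then j else i), ?_, ?_⟩
    · rw [CoxeterSystem.alternatingWord_succ', CoxeterSystem.wordProd_cons]
      simp [← mul_assoc, ← hv]
    · have := (cs.isRightDescent_iff).mp hd
      omega
  have hprev : ¬ cs.IsRightDescent v (if Even k then i else j) := by
    intro hd
    have hd' := (cs.isRightDescent_iff).mp hd
    have hw' : w = v * cs.simple (if Even k then i else j) *
        cs.wordProd (CoxeterSystem.alternatingWord i j k') := by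
      conv_lhs => rw [hv]
      rw [hk', CoxeterSystem.alternatingWord_succ', CoxeterSystem.wordProd_cons, ← mul_assoc]
      by_cases he : Even k' <;> simp [he, Nat.even_add_one]
    have h1 := cs.length_mul_le (v * cs.simple (if Even k then i else j))
      (cs.wordProd (CoxeterSystem.alternatingWord i j k'))
    rw [← hw'] at h1
    have := hlen i j k'
    omega
  have hboth : 0 ≤ rep cs v (root i) ∧ 0 ≤ rep cs v (root j) := by
    have h1 := ih (cs.length v) (by omega) v _ hnext rfl
    have h2 := ih (cs.length v) (by omega) v _ hprev rfl
    split_ifs at h1 h2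
    · exact ⟨h2, h1⟩
    · exact ⟨h1, h2⟩
  have hkm : M i j ≠ 0 → k + 1 ≤ M i j := by
    intro hm
    by_contra hlt
    rw [M.symmetric i j] at hm hlt
    have hred := cs.not_isReduced_alternatingWord j i hm (m := k + 1) (by omega)
    apply hred
    have hw' : w * cs.simple i = v * cs.wordProd (CoxeterSystem.alternatingWord j i (k + 1)) := by
      rw [CoxeterSystem.alternatingWord_succ, CoxeterSystem.wordProd_concat, ← mul_assoc, ← hv]
    have h1 := (cs.not_isRightDescent_iff).mp h
    have h2 := cs.length_mul_le v (cs.wordProd (CoxeterSystem.alternatingWord j i (k + 1)))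
    rw [← hw'] at h2
    have h3 := hlen j i (k + 1)
    rw [CoxeterSystem.IsReduced, CoxeterSystem.length_alternatingWord]
    omega
  have hm1 := M.off_diagonal i j hij
  have c1 := S_eval_nonneg (M i j) hm1 k (by omega) (fun hm => by have := hkm hm; omega)
  have c2 := S_eval_nonneg (M i j) hm1 (k - 1) (by omega) (fun hm => by have := hkm hm; omega)
  rw [hv, rep_mul_apply, rep_alternatingWord_root]
  split_ifs <;> simp only [map_add, map_smul]
  · exact add_nonneg (smul_nonneg c1 hboth.1) (smul_nonneg c2 hboth.2)
  · exact add_nonneg (smul_nonneg c2 hboth.1) (smul_nonneg c1 hboth.2)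

end Positivity

section InvariantForm

/-- A positive definite symmetric form invariant under the geometric representation. -/
structure IsInvariantForm (b : LinearMap.BilinForm ℝ (B →₀ ℝ)) : Prop where
  symm : ∀ x y, b x y = b y x
  pos : ∀ x, x ≠ 0 → 0 < b x x
  invariant : ∀ g x y, b (rep cs g x) (rep cs g y) = b x y

lemma exists_isInvariantForm [Finite B] [Finite W] :
    ∃ b : LinearMap.BilinForm ℝ (B →₀ ℝ), IsInvariantForm cs b := by
  have := Fintype.ofFinite B
  have := Fintype.ofFinite W
  let f (g : W) (i : B) : Dual ℝ (B →₀ ℝ) := Finsupp.lapply i ∘ₗ (rep cs g).toLinearMap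
  let b : LinearMap.BilinForm ℝ (B →₀ ℝ) :=
    ∑ g : W, ∑ i : B, (LinearMap.mul ℝ ℝ).compl₁₂ (f g i) (f g i)
  have hb (x y : B →₀ ℝ) : b x y = ∑ g : W, ∑ i : B, rep cs g x i * rep cs g y i := by
    simp [b, f, LinearMap.sum_apply]
  refine ⟨b, fun x y => ?_, fun x hx => ?_, fun g x y => ?_⟩
  · simp only [hb, mul_comm]
  · rw [hb]
    have hnn (g : W) : 0 ≤ ∑ i : B, rep cs g x i * rep cs g x i :=
      Finset.sum_nonneg fun i _ => mul_self_nonneg _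
    refine Finset.sum_pos' (fun g _ => hnn g) ⟨1, Finset.mem_univ _, ?_⟩
    obtain ⟨i, hi⟩ := Finsupp.ne_iff.mp hx
    refine Finset.sum_pos' (fun i _ => mul_self_nonneg _) ⟨i, Finset.mem_univ _, ?_⟩
    rw [rep_one_apply]
    exact mul_self_pos.mpr hi
  · simp only [hb, ← rep_mul_apply]
    exact Fintype.sum_equiv (Equiv.mulRight g) _ _ fun _ => rfl

variable {cs} {b : LinearMap.BilinForm ℝ (B →₀ ℝ)}

lemma IsInvariantForm.nondegenerate (hb : IsInvariantForm cs b) : b.Nondegenerate := by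
  have hl : b.SeparatingLeft := by
    intro x hx
    by_contra h
    exact (hb.pos x h).ne' (hx x)
  refine ⟨hl, fun y hy => hl y fun x => ?_⟩
  rw [hb.symm, hy]

lemma IsInvariantForm.isRefl (hb : IsInvariantForm cs b) : b.IsRefl := fun x y h => by
  rw [hb.symm, h]

lemma IsInvariantForm.coroot_mul (hb : IsInvariantForm cs b) (i : B) (x : B →₀ ℝ) :
    coroot M i x * b (root i) (root i) = 2 * b x (root i) := by
  have h := hb.invariant (cs.simple i) x (root i)
  rw [rep_simple_root, rep_simple, simpleRefl_apply] at h
  simp only [map_sub, map_smul, map_neg, LinearMap.sub_apply, LinearMap.smul_apply,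
    smul_eq_mul] at h
  linarith

lemma root_ne_zero (i : B) : root i ≠ (0 : B →₀ ℝ) := by simp [root]

end InvariantForm

section Fixed

/-- The displacement `g - 1` of a group element. -/
noncomputable def displacement (g : W) : (B →₀ ℝ) →ₗ[ℝ] (B →₀ ℝ) :=
  (rep cs g).toLinearMap - LinearMap.id

/-- The fixed space of a group element. -/
noncomputable def fixed (g : W) : Submodule ℝ (B →₀ ℝ) := LinearMap.ker (displacement cs g)

lemma displacement_apply (g : W) (x : B →₀ ℝ) : displacement cs g x = rep cs g x - x := rfl

lemma mem_fixed {g : W} {x : B →₀ ℝ} : x ∈ fixed cs g ↔ rep cs g x = x := by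
  rw [fixed, LinearMap.mem_ker, displacement_apply, sub_eq_zero]

/-- The common fixed space of the entries of a list. -/
noncomputable def commonFixed (l : List W) : Submodule ℝ (B →₀ ℝ) := ⨅ t ∈ l, fixed cs t

lemma mem_commonFixed {l : List W} {x : B →₀ ℝ} :
    x ∈ commonFixed cs l ↔ ∀ t ∈ l, rep cs t x = x := by
  simp [commonFixed, Submodule.mem_iInf, mem_fixed]

lemma commonFixed_cons (t : W) (l : List W) :
    commonFixed cs (t :: l) = fixed cs t ⊓ commonFixed cs l := by
  ext x
  simp [mem_commonFixed, mem_fixed]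

lemma commonFixed_le_fixed_prod (l : List W) : commonFixed cs l ≤ fixed cs l.prod := by
  intro x hx
  rw [mem_commonFixed] at hx
  rw [mem_fixed]
  induction l with
  | nil => exact rep_one_apply cs x
  | cons t l ih =>
    rw [List.prod_cons, rep_mul_apply, ih fun s hs => hx s (List.mem_cons_of_mem _ hs)]
    exact hx t List.mem_cons_self

lemma rep_conj_apply (g : W) (i : B) (x : B →₀ ℝ) :
    rep cs (g * cs.simple i * g⁻¹) x = x - coroot M i (rep cs g⁻¹ x) • rep cs g (root i) := by
  rw [rep_mul_apply, rep_mul_apply, rep_simple, simpleRefl_apply, map_sub, map_smul,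
    ← rep_mul_apply, mul_inv_cancel, rep_one_apply]

lemma finrank_le_finrank_fixed_reflection [Finite B] {t : W} (ht : cs.IsReflection t) :
    finrank ℝ (B →₀ ℝ) ≤ finrank ℝ (fixed cs t) + 1 := by
  obtain ⟨g, i, rfl⟩ := ht
  let φ : Dual ℝ (B →₀ ℝ) := coroot M i ∘ₗ (rep cs g⁻¹).toLinearMap
  have h1 : LinearMap.ker φ ≤ fixed cs (g * cs.simple i * g⁻¹) := by
    intro x hx
    have hx' : coroot M i (rep cs g⁻¹ x) = 0 := hx
    rw [mem_fixed, rep_conj_apply, hx', zero_smul, sub_zero]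
  have h2 := Submodule.finrank_mono h1
  have h3 := φ.finrank_range_add_finrank_ker
  have h4 := (LinearMap.range φ).finrank_le
  rw [finrank_self] at h4
  omega

lemma finrank_le_finrank_commonFixed [Finite B] (l : List W) (hl : ∀ t ∈ l, cs.IsReflection t) :
    finrank ℝ (B →₀ ℝ) ≤ finrank ℝ (commonFixed cs l) + l.length := by
  induction l with
  | nil =>
    have : commonFixed cs [] = ⊤ := by
      ext x
      simp [mem_commonFixed]
    rw [this, finrank_top]
    simp
  | cons t l ih =>
    have h1 := ih fun s hs => hl s (List.mem_cons_of_mem _ hs)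
    have h2 := finrank_le_finrank_fixed_reflection cs (hl t List.mem_cons_self)
    have h3 := Submodule.finrank_sup_add_finrank_inf_eq (fixed cs t) (commonFixed cs l)
    have h4 := (fixed cs t ⊔ commonFixed cs l).finrank_le
    rw [commonFixed_cons, List.length_cons]
    omega

variable {cs} in
lemma IsInvariantForm.mem_range_displacement [Finite B] {b : LinearMap.BilinForm ℝ (B →₀ ℝ)}
    (hb : IsInvariantForm cs b) (g : W) (α : B →₀ ℝ) :
    α ∈ LinearMap.range (displacement cs g) ↔ ∀ x ∈ fixed cs g, b x α = 0 := by
  constructor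
  · rintro ⟨z, rfl⟩ x hx
    rw [mem_fixed] at hx
    rw [displacement_apply, map_sub, sub_eq_zero]
    conv_lhs => rw [← hx, hb.invariant]
  · intro h
    rw [← LinearMap.BilinForm.orthogonal_orthogonal hb.nondegenerate hb.isRefl
      (LinearMap.range (displacement cs g))]
    intro x hx
    refine h x ((mem_fixed cs).mpr ?_)
    have key (z : B →₀ ℝ) : b z (rep cs g⁻¹ x - x) = 0 := by
      have h1 : b (displacement cs g z) x = 0 := hx _ ⟨z, rfl⟩
      rw [displacement_apply, map_sub, LinearMap.sub_apply,
        ← hb.invariant g⁻¹ (rep cs g z) x, ← rep_mul_apply, inv_mul_cancel, rep_one_apply] at h1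
      rw [map_sub, h1]
    have h2 : rep cs g⁻¹ x = x := by
      by_contra hne
      exact (hb.pos _ (sub_ne_zero.mpr hne)).ne' (key _)
    simpa using rep_inv_apply_eq cs g⁻¹ h2

lemma range_displacement_mono [Finite B] [Finite W] {u v : W} (h : fixed cs v ≤ fixed cs u) :
    LinearMap.range (displacement cs u) ≤ LinearMap.range (displacement cs v) := by
  obtain ⟨b, hb⟩ := exists_isInvariantForm cs
  intro α hα
  rw [hb.mem_range_displacement] at hα ⊢
  exact fun x hx => hα x (h hx)

end Fixed

section Carter

variable {cs} in
lemma IsInvariantForm.apply_nonneg {b : LinearMap.BilinForm ℝ (B →₀ ℝ)} {y z : B →₀ ℝ}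
    (hy : ∀ i, 0 ≤ b y (root i)) (hz : 0 ≤ z) : 0 ≤ b y z := by
  have h : b y = Finsupp.linearCombination ℝ fun i => b y (root i) := by
    ext i
    simp [root]
  rw [h, Finsupp.linearCombination_apply]
  exact Finset.sum_nonneg fun i _ => mul_nonneg (hz i) (hy i)

/-- The fixed space of a nontrivial element lies in some reflecting hyperplane. -/
theorem exists_isReflection_fixed_le [Finite B] [Finite W] {w : W} (hw : w ≠ 1) :
    ∃ t, cs.IsReflection t ∧ fixed cs w ≤ fixed cs t := by
  obtain ⟨b, hb⟩ := exists_isInvariantForm cs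
  by_contra! hno
  obtain ⟨x, hxw, hx⟩ := Dual.exists_forall_mem_ne_zero_of_forall_exists (fixed cs w)
    (fun p : W × B => coroot M p.2 ∘ₗ (rep cs p.1).toLinearMap) (by
      rintro ⟨g, i⟩
      obtain ⟨x, hx, hxt⟩ := SetLike.not_le_iff_exists.mp (hno _ ⟨g⁻¹, i, rfl⟩)
      refine ⟨x, hx, fun h0 => hxt ?_⟩
      have h0' : coroot M i (rep cs g x) = 0 := h0
      rw [mem_fixed, rep_conj_apply, inv_inv, h0', zero_smul, sub_zero])
  let L : Dual ℝ (B →₀ ℝ) := Finsupp.linearCombination ℝ fun _ => (1 : ℝ)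
  have hL (i : B) : L (root i) = 1 := by simp [L, root]
  obtain ⟨g, hg⟩ := Finite.exists_max fun g : W => L (rep cs g x)
  set y := rep cs g x with hy
  have hdom (i : B) : 0 < b y (root i) := by
    have h1 := hg (cs.simple i * g)
    rw [rep_mul_apply, ← hy, rep_simple, simpleRefl_apply, map_sub, map_smul, hL] at h1
    have h2 : coroot M i y ≠ 0 := hx (g, i)
    have h3 : 0 < coroot M i y := lt_of_le_of_ne (by simpa using h1) h2.symm
    have h4 := hb.coroot_mul i y
    have h5 := mul_pos h3 (hb.pos _ (root_ne_zero i))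
    linarith
  have hne : (g * w * g⁻¹)⁻¹ ≠ 1 := by
    rwa [ne_eq, inv_eq_one, conj_eq_one_iff]
  have hfix : rep cs (g * w * g⁻¹)⁻¹ y = y := by
    apply rep_inv_apply_eq
    rw [hy, ← rep_mul_apply, inv_mul_cancel_right, rep_mul_apply, (mem_fixed cs).mp hxw]
  obtain ⟨i, hi⟩ := cs.exists_rightDescent_of_ne_one hne
  have hpos := rep_root_nonneg cs _ i (cs.isRightDescent_iff_not_isRightDescent_mul.mp hi)
  rw [rep_mul_apply, rep_simple_root, map_neg] at hpos
  have h1 := IsInvariantForm.apply_nonneg (fun j => (hdom j).le) hpos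
  have h2 := hb.invariant (g * w * g⁻¹)⁻¹ y (root i)
  rw [hfix] at h2
  rw [map_neg] at h1
  have h3 := hdom i
  linarith

lemma exists_reflection_list [Finite B] [Finite W] (w : W) :
    ∃ l : List W, l.length + finrank ℝ (fixed cs w) ≤ finrank ℝ (B →₀ ℝ) ∧
      (∀ t ∈ l, cs.IsReflection t) ∧ l.prod = w := by
  induction hn : finrank ℝ (B →₀ ℝ) - finrank ℝ (fixed cs w) using Nat.strong_induction_on
    generalizing w with
  | _ n ih =>
  by_cases hw : w = 1
  · exact ⟨[], by simpa using (fixed cs w).finrank_le, by simp, by simp [hw]⟩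
  obtain ⟨_, ⟨g, i, rfl⟩, hle⟩ := exists_isReflection_fixed_le cs hw
  obtain ⟨b, hb⟩ := exists_isInvariantForm cs
  have hα0 : rep cs g (root i) ≠ 0 := by
    simpa using root_ne_zero i
  have hφ (x : B →₀ ℝ) : coroot M i (rep cs g⁻¹ x) * b (rep cs g (root i)) (rep cs g (root i)) =
      2 * b x (rep cs g (root i)) := by
    rw [hb.invariant, hb.coroot_mul, ← hb.invariant g, ← rep_mul_apply, mul_inv_cancel,
      rep_one_apply]
  set t := g * cs.simple i * g⁻¹ with ht
  have htr : cs.IsReflection t := ⟨g, i, rfl⟩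
  set α := rep cs g (root i) with hα
  obtain ⟨x, hx⟩ := (hb.mem_range_displacement w α).mpr (by
    intro x hx
    have h1 := (mem_fixed cs).mp (hle hx)
    rw [rep_conj_apply, sub_eq_self, smul_eq_zero, or_iff_left hα0] at h1
    have h2 := hφ x
    rw [h1, zero_mul] at h2
    linarith)
  rw [displacement_apply, sub_eq_iff_eq_add] at hx
  have htx : rep cs t x = rep cs w x := by
    have h1 := hb.invariant w x x
    rw [hx] at h1
    simp only [map_add, LinearMap.add_apply, hb.symm α x] at h1
    have h2 := hφ x
    have h3 : (coroot M i (rep cs g⁻¹ x) + 1) * b α α = 0 := by linarith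
    have h4 : coroot M i (rep cs g⁻¹ x) = -1 := by
      have := (mul_eq_zero.mp h3).resolve_right (hb.pos _ hα0).ne'
      linarith
    rw [rep_conj_apply, h4, hx]
    module
  have hlt : fixed cs w < fixed cs (t * w) := by
    refine SetLike.lt_iff_le_and_exists.mpr ⟨fun z hz => ?_, x, ?_, fun hxw => ?_⟩
    · rw [mem_fixed, rep_mul_apply, (mem_fixed cs).mp hz]
      exact (mem_fixed cs).mp (hle hz)
    · rw [mem_fixed, rep_mul_apply, ← htx, ← rep_mul_apply, htr.mul_self, rep_one_apply]
    · rw [mem_fixed, hx, add_eq_right] at hxw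
      exact hα0 hxw
  have hlt' := Submodule.finrank_lt_finrank_of_lt hlt
  have hle' := (fixed cs (t * w)).finrank_le
  obtain ⟨l, hl1, hl2, hl3⟩ := ih _ (by omega) (t * w) rfl
  refine ⟨t :: l, ?_, ?_, ?_⟩
  · rw [List.length_cons]; omega
  · simpa using ⟨htr, hl2⟩
  · rw [List.prod_cons, hl3, ← mul_assoc, htr.mul_self, one_mul]

lemma reflLen_le (l : List W) (hl : ∀ t ∈ l, cs.IsReflection t) :
    reflLen cs l.prod ≤ l.length :=
  Nat.sInf_le ⟨l, rfl, hl, rfl⟩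

lemma exists_reflLen_eq (w : W) :
    ∃ l : List W, l.length = reflLen cs w ∧ (∀ t ∈ l, cs.IsReflection t) ∧ l.prod = w := by
  refine Nat.sInf_mem
    (s := {k | ∃ l : List W, l.length = k ∧ (∀ t ∈ l, cs.IsReflection t) ∧ l.prod = w}) ?_
  obtain ⟨ω, rfl⟩ := cs.wordProd_surjective w
  refine ⟨_, ω.map cs.simple, rfl, ?_, rfl⟩
  simpa using fun i _ => cs.isReflection_simple i

lemma reflLen_mul_le (u v : W) : reflLen cs (u * v) ≤ reflLen cs u + reflLen cs v := by
  obtain ⟨l, h1, h2, rfl⟩ := exists_reflLen_eq cs u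
  obtain ⟨l', h1', h2', rfl⟩ := exists_reflLen_eq cs v
  rw [← h1, ← h1', ← List.prod_append, ← List.length_append]
  apply reflLen_le
  simp only [List.mem_append]
  rintro t (ht | ht)
  exacts [h2 t ht, h2' t ht]

/-- Carter's lemma: the reflection length is the codimension of the fixed space. -/
theorem reflLen_add_finrank_fixed [Finite B] [Finite W] (w : W) :
    reflLen cs w + finrank ℝ (fixed cs w) = finrank ℝ (B →₀ ℝ) := by
  apply le_antisymm
  · obtain ⟨l, h1, h2, rfl⟩ := exists_reflection_list cs w
    have := reflLen_le cs l h2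
    omega
  · obtain ⟨l, h1, h2, rfl⟩ := exists_reflLen_eq cs w
    have := finrank_le_finrank_commonFixed cs l h2
    have := Submodule.finrank_mono (commonFixed_le_fixed_prod cs l)
    omega

end Carter

section AbsoluteOrder

lemma absLe_trans {u v w : W} (huv : absLe cs u v) (hvw : absLe cs v w) : absLe cs u w := by
  have h1 := reflLen_mul_le cs (u⁻¹ * v) (v⁻¹ * w)
  have h2 := reflLen_mul_le cs u (u⁻¹ * w)
  rw [mul_assoc, mul_inv_cancel_left] at h1
  rw [mul_inv_cancel_left] at h2
  unfold absLe at *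
  omega

lemma mem_fixed_inv_mul {u w : W} {x : B →₀ ℝ} :
    x ∈ fixed cs (u⁻¹ * w) ↔ rep cs w x = rep cs u x := by
  rw [mem_fixed, rep_mul_apply]
  constructor
  · intro h
    rw [← rep_inv_apply_eq cs _ h, inv_inv]
  · intro h
    exact rep_inv_apply_eq cs u h.symm

variable [Finite B] [Finite W]

lemma finrank_comap_le {K V : Type*} [Field K] [AddCommGroup V] [Module K V]
    [FiniteDimensional K V] (f : V →ₗ[K] V) (p : Submodule K V) :
    finrank K (p.comap f) ≤ finrank K (LinearMap.ker f) + finrank K p := by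
  have h1 := (f.domRestrict (p.comap f)).finrank_range_add_finrank_ker
  have h2 : LinearMap.range (f.domRestrict (p.comap f)) ≤ p := by
    rintro _ ⟨x, rfl⟩
    exact x.2
  have h3 : (LinearMap.ker (f.domRestrict (p.comap f))).map (p.comap f).subtype ≤
      LinearMap.ker f := by
    rintro _ ⟨x, hx, rfl⟩
    exact hx
  have h4 := Submodule.finrank_mono h3
  rw [Submodule.finrank_map_subtype_eq] at h4
  have h5 := Submodule.finrank_mono h2
  omega

lemma finrank_range_displacement (u : W) :
    finrank ℝ (LinearMap.range (displacement cs u)) = reflLen cs u := by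
  have h1 := (displacement cs u).finrank_range_add_finrank_ker
  have h2 := reflLen_add_finrank_fixed cs u
  rw [fixed] at h2
  omega

lemma fixed_inv_mul_eq_comap {u w : W} (h : absLe cs u w) :
    fixed cs (u⁻¹ * w) = (LinearMap.range (displacement cs u)).comap (displacement cs w) := by
  apply Submodule.eq_of_le_of_finrank_le
  · intro x hx
    rw [mem_fixed_inv_mul] at hx
    exact ⟨x, by rw [displacement_apply, displacement_apply, hx]⟩
  · have h1 := finrank_comap_le (displacement cs w) (LinearMap.range (displacement cs u))
    rw [finrank_range_displacement, ← fixed] at h1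
    have h2 := reflLen_add_finrank_fixed cs w
    have h3 := reflLen_add_finrank_fixed cs (u⁻¹ * w)
    unfold absLe at h
    omega

lemma fixed_le_of_absLe {u w : W} (h : absLe cs u w) : fixed cs w ≤ fixed cs u := by
  have h1 : fixed cs u ⊓ fixed cs (u⁻¹ * w) ≤ fixed cs w := by
    rintro x ⟨hx, hx'⟩
    have hx' := (mem_fixed_inv_mul cs).mp hx'
    rwa [(mem_fixed cs).mp hx, ← mem_fixed] at hx'
  have h2 := Submodule.finrank_sup_add_finrank_inf_eq (fixed cs u) (fixed cs (u⁻¹ * w))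
  have h3 := (fixed cs u ⊔ fixed cs (u⁻¹ * w)).finrank_le
  have h4 := reflLen_add_finrank_fixed cs u
  have h5 := reflLen_add_finrank_fixed cs (u⁻¹ * w)
  have h6 := reflLen_add_finrank_fixed cs w
  have h7 : fixed cs u ⊓ fixed cs (u⁻¹ * w) = fixed cs w := by
    apply Submodule.eq_of_le_of_finrank_le h1
    unfold absLe at h
    omega
  exact h7 ▸ inf_le_left

/-- Below a common upper bound, the absolute order is reverse inclusion of fixed spaces. -/
theorem absLe_of_fixed_le {u v w : W} (hu : absLe cs u w) (hv : absLe cs v w)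
    (h : fixed cs v ≤ fixed cs u) : absLe cs u v := by
  have hsub : fixed cs (u⁻¹ * w) ≤ fixed cs (v⁻¹ * w) := by
    rw [fixed_inv_mul_eq_comap cs hu, fixed_inv_mul_eq_comap cs hv]
    exact Submodule.comap_mono (range_displacement_mono cs h)
  have hsup : fixed cs (u⁻¹ * w) ⊔ fixed cs v ≤ fixed cs (u⁻¹ * v) := by
    refine sup_le (fun x hx => ?_) fun x hx => ?_
    · have h1 := (mem_fixed_inv_mul cs).mp hx
      have h2 := (mem_fixed_inv_mul cs).mp (hsub hx)
      rw [mem_fixed_inv_mul, ← h2, h1]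
    · rw [mem_fixed_inv_mul, (mem_fixed cs).mp hx, (mem_fixed cs).mp (h hx)]
  have hinf : fixed cs (u⁻¹ * w) ⊓ fixed cs v ≤ fixed cs w := by
    rintro x ⟨hx, hx'⟩
    have h1 := (mem_fixed_inv_mul cs).mp (hsub hx)
    rwa [(mem_fixed cs).mp hx', ← mem_fixed] at h1
  have h1 := Submodule.finrank_mono hsup
  have h2 := Submodule.finrank_mono hinf
  have h3 := Submodule.finrank_sup_add_finrank_inf_eq (fixed cs (u⁻¹ * w)) (fixed cs v)
  have h4 := reflLen_add_finrank_fixed cs u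
  have h5 := reflLen_add_finrank_fixed cs v
  have h6 := reflLen_add_finrank_fixed cs w
  have h7 := reflLen_add_finrank_fixed cs (u⁻¹ * w)
  have h8 := reflLen_add_finrank_fixed cs (u⁻¹ * v)
  have h9 := reflLen_mul_le cs u (u⁻¹ * v)
  rw [mul_inv_cancel_left] at h9
  unfold absLe at *
  omega

end AbsoluteOrder

section ReducedLists

variable {cs} in
lemma exists_prod_eq_mul_of_sublist {l L : List W} (h : l.Sublist L)
    (hL : ∀ t ∈ L, cs.IsReflection t) :
    ∃ r : List W, r.length + l.length = L.length ∧ (∀ t ∈ r, cs.IsReflection t) ∧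
      L.prod = l.prod * r.prod := by
  induction h with
  | slnil => exact ⟨[], by simp⟩
  | @cons l L a _ ih =>
    obtain ⟨r, h1, h2, h3⟩ := ih fun t ht => hL t (List.mem_cons_of_mem _ ht)
    refine ⟨l.prod⁻¹ * a * l.prod⁻¹⁻¹ :: r, by simp only [List.length_cons]; omega, ?_, ?_⟩
    · simp only [List.mem_cons, forall_eq_or_imp]
      exact ⟨(hL a List.mem_cons_self).conj _, h2⟩
    · simp only [List.prod_cons, h3]
      group
  | @cons_cons l L a _ ih =>
    obtain ⟨r, h1, h2, h3⟩ := ih fun t ht => hL t (List.mem_cons_of_mem _ ht)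
    exact ⟨r, by simp only [List.length_cons]; omega, h2, by
      simp only [List.prod_cons, h3, mul_assoc]⟩

/-- A list of reflections of minimal length among those with the same product. -/
structure IsReducedList (l : List W) : Prop where
  isReflection : ∀ t ∈ l, cs.IsReflection t
  length_eq : l.length = reflLen cs l.prod

variable {cs}

lemma IsReducedList.of_sublist {l L : List W} (hL : IsReducedList cs L) (h : l.Sublist L) :
    IsReducedList cs l ∧ absLe cs l.prod L.prod := by
  have hl : ∀ t ∈ l, cs.IsReflection t := fun t ht => hL.isReflection t (h.subset ht)
  obtain ⟨r, h1, h2, h3⟩ := exists_prod_eq_mul_of_sublist h hL.isReflection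
  have h4 := reflLen_le cs l hl
  have h5 := reflLen_le cs r h2
  have h6 := reflLen_mul_le cs l.prod r.prod
  have h7 := hL.length_eq
  rw [h3] at h7
  refine ⟨⟨hl, by omega⟩, ?_⟩
  rw [absLe, h3, inv_mul_cancel_left]
  omega

lemma exists_list_prod_of_mem_closure {l : List W} (hl : ∀ t ∈ l, cs.IsReflection t) {u : W}
    (hu : u ∈ Subgroup.closure {t | t ∈ l}) : ∃ r : List W, (∀ t ∈ r, t ∈ l) ∧ r.prod = u := by
  rw [← Subgroup.mem_toSubmonoid, Subgroup.closure_toSubmonoid] at hu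
  obtain ⟨r, hr, hprod⟩ := Submonoid.exists_list_of_mem_closure hu
  refine ⟨r, fun t ht => ?_, hprod⟩
  rcases hr t ht with h | h
  · exact h
  · have h' : t⁻¹ ∈ l := h
    rwa [← (hl _ h').inv, inv_inv] at h'

lemma eq_filter_of_sublist {α : Type*} [DecidableEq α] {l L : List α} (h : l.Sublist L)
    (hL : L.Nodup) : l = L.filter (· ∈ l) := by
  induction h with
  | slnil => rfl
  | @cons l L a h ih =>
    rw [List.nodup_cons] at hL
    rw [List.filter_cons_of_neg (by simpa using fun ha => hL.1 (h.subset ha))]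
    exact ih hL.2
  | @cons_cons l L a h ih =>
    rw [List.nodup_cons] at hL
    rw [List.filter_cons_of_pos (by simp)]
    congr 1
    conv_lhs => rw [ih hL.2]
    apply List.filter_congr
    intro x hx
    have : x ≠ a := by rintro rfl; exact hL.1 hx
    simp [this]

lemma length_filter_or_add_length_filter_and {α : Type*} (L : List α) (p q : α → Bool) :
    (L.filter fun t => p t || q t).length + (L.filter fun t => p t && q t).length =
      (L.filter p).length + (L.filter q).length := by
  induction L with
  | nil => rfl
  | cons a L ih =>
    cases hp : p a <;> cases hq : q a <;> simp [hp, hq] <;> omega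

variable [Finite B] [Finite W]

lemma IsReducedList.fixed_prod {l : List W} (hl : IsReducedList cs l) :
    fixed cs l.prod = commonFixed cs l := by
  refine (Submodule.eq_of_le_of_finrank_le (commonFixed_le_fixed_prod cs l) ?_).symm
  have h1 := reflLen_add_finrank_fixed cs l.prod
  have h2 := finrank_le_finrank_commonFixed cs l hl.isReflection
  have h3 := hl.length_eq
  omega

lemma IsReducedList.finrank_commonFixed {l : List W} (hl : IsReducedList cs l) :
    l.length + finrank ℝ (commonFixed cs l) = finrank ℝ (B →₀ ℝ) := by
  rw [← hl.fixed_prod, hl.length_eq, reflLen_add_finrank_fixed]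

lemma IsReducedList.commonFixed_filter_and {L : List W} (hL : IsReducedList cs L)
    (p q : W → Bool) :
    commonFixed cs (L.filter fun t => p t && q t) =
      commonFixed cs (L.filter p) ⊔ commonFixed cs (L.filter q) := by
  have hf (r : W → Bool) := (hL.of_sublist (List.filter_sublist (p := r))).1.finrank_commonFixed
  have hinf : commonFixed cs (L.filter p) ⊓ commonFixed cs (L.filter q) =
      commonFixed cs (L.filter fun t => p t || q t) := by
    ext x
    simp only [Submodule.mem_inf, mem_commonFixed, List.mem_filter, Bool.or_eq_true]
    grind
  refine (Submodule.eq_of_le_of_finrank_le (sup_le ?_ ?_) ?_).symm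
  · intro x
    simp only [mem_commonFixed, List.mem_filter, Bool.and_eq_true]
    grind
  · intro x
    simp only [mem_commonFixed, List.mem_filter, Bool.and_eq_true]
    grind
  · have h1 := Submodule.finrank_sup_add_finrank_inf_eq (commonFixed cs (L.filter p))
      (commonFixed cs (L.filter q))
    rw [hinf] at h1
    have h2 := hf p
    have h3 := hf q
    have h4 := hf fun t => p t || q t
    have h5 := hf fun t => p t && q t
    have h6 := length_filter_or_add_length_filter_and L p q
    omega

end ReducedLists

end Helpers

/-- Let `W` be a finite Coxeter group (= finite real reflection group), `c` a standard
Coxeter element (product of all the simple reflections in some order), and for each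
`w ∈ NC(W,c)` let `cf w` be its canonical factorization, i.e. the minimal-length reflection
word whose entries are the simple generators of the parabolic subgroup `W_{Fix(w)}`
(hypotheses `hcf1`–`hcf6`).  Then for any `u, w ∈ NC(W,c)` with `u ≤ w` in absolute order,
there exists a unique `v ∈ NC(W,c)` with `u ≪ v ⊏ w`. -/
theorem stmt_9 [Finite W] (c : W)
    (hcox : ∃ l : List B, l.Nodup ∧ (∀ i : B, i ∈ l) ∧ c = cs.wordProd l)
    (hcf1 : ∀ w, absLe cs w c → ∀ t ∈ cf w, cs.IsReflection t)
    (hcf2 : ∀ w, absLe cs w c → (cf w).prod = w)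
    (hcf3 : ∀ w, absLe cs w c → (cf w).length = reflLen cs w)
    (hcf4 : ∀ w, absLe cs w c → (cf w).Nodup)
    (hcf5 : ∀ w, absLe cs w c → ∀ v, absLe cs v w → v ∈ Subgroup.closure {t | t ∈ cf w})
    (hcf6 : ∀ w, absLe cs w c → ∀ l : List W, l.Sublist (cf w) →
      ∀ t : W, (t ∈ cf l.prod ↔ t ∈ l)) :
    ∀ u w : W, absLe cs u c → absLe cs w c → absLe cs u w →
      ∃! v : W, absLe cs v c ∧ ll cs cf u v ∧ sqsub cf v w := by
  classical
  intro u w _ hw huw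
  obtain ⟨lB, -, hlB, -⟩ := hcox
  have : Finite B := Set.finite_univ_iff.mp ((List.finite_toSet lB).subset fun i _ => hlB i)
  have hred : IsReducedList cs (cf w) := ⟨hcf1 w hw, by rw [hcf2 w hw, hcf3 w hw]⟩
  have hsub {l : List W} (hl : l.Sublist (cf w)) :
      IsReducedList cs l ∧ absLe cs l.prod w := by
    simpa only [hcf2 w hw] using hred.of_sublist hl
  have hsupp {l l' : List W} (hl : l.Sublist (cf w)) (hl' : l'.Sublist (cf w))
      (hv : ll cs cf u l.prod) (hv' : ll cs cf u l'.prod) : ∀ t ∈ l, t ∈ l' := by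
    intro t ht
    set m := (cf w).filter fun t => (t ∈ l : Bool) && (t ∈ l' : Bool) with hm
    have hmw : m.Sublist (cf w) := List.filter_sublist
    have hfix : fixed cs m.prod ≤ fixed cs u := by
      rw [(hsub hmw).1.fixed_prod, hred.commonFixed_filter_and,
        ← eq_filter_of_sublist hl (hcf4 w hw), ← eq_filter_of_sublist hl' (hcf4 w hw),
        ← (hsub hl).1.fixed_prod, ← (hsub hl').1.fixed_prod]
      exact sup_le (fixed_le_of_absLe cs hv.1) (fixed_le_of_absLe cs hv'.1)
    have hum := absLe_of_fixed_le cs huw (hsub hmw).2 hfix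
    have hmc := absLe_trans cs (hsub hmw).2 hw
    obtain ⟨r, hr, hru⟩ := exists_list_prod_of_mem_closure (hcf1 _ hmc) (hcf5 _ hmc u hum)
    have hrm (s : W) (hs : s ∈ r) : s ∈ l ∧ s ∈ l' := by
      have := (hcf6 w hw m hmw s).mp (hr s hs)
      rw [hm, List.mem_filter] at this
      simpa using this.2
    exact (hrm t (hv.2 r (fun s hs => (hcf6 w hw l hl s).mpr (hrm s hs).1) hru t
      ((hcf6 w hw l hl t).mpr ht))).2
  have hex : ∃ n, ∃ l : List W, l.Sublist (cf w) ∧ absLe cs u l.prod ∧ l.length = n :=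
    ⟨_, cf w, List.Sublist.refl _, by rwa [hcf2 w hw], rfl⟩
  obtain ⟨l, hl, hul, hlen⟩ := Nat.find_spec hex
  have hlu : ll cs cf u l.prod := by
    refine ⟨hul, fun r hr hru t ht => ?_⟩
    by_contra htr
    have ht' := (hcf6 w hw l hl t).mp ht
    have hlt : (l.filter (· ≠ t)).length < l.length :=
      List.length_filter_lt_length_iff_exists.mpr ⟨t, ht', by simp⟩
    have hsl : (l.filter (· ≠ t)).Sublist (cf w) := List.filter_sublist.trans hl
    refine Nat.find_min hex (hlen ▸ hlt) ⟨_, hsl, ?_, rfl⟩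
    refine absLe_of_fixed_le cs huw (hsub hsl).2 ?_
    rw [(hsub hsl).1.fixed_prod, ← hru]
    refine le_trans (fun x hx => ?_) (commonFixed_le_fixed_prod cs r)
    rw [mem_commonFixed] at hx ⊢
    intro s hs
    refine hx s (List.mem_filter.mpr ⟨(hcf6 w hw l hl s).mp (hr s hs), ?_⟩)
    simpa using fun h : s = t => htr (h ▸ hs)
  refine ⟨l.prod, ⟨absLe_trans cs (hsub hl).2 hw, hlu, l, hl, rfl⟩, ?_⟩
  rintro _ ⟨-, hv, l', hl', rfl⟩
  rw [eq_filter_of_sublist hl (hcf4 w hw), eq_filter_of_sublist hl' (hcf4 w hw)]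
  congr 1
  apply List.filter_congr
  intro t _
  simpa using ⟨hsupp hl' hl hv hlu t, hsupp hl hl' hlu hv t⟩

end Stmt9
end
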